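/- Let H be a Hopf algebra over a field k with bijective antipode, and H^e = H ⊗_k H^op its enveloping algebra. Then l.Ggldim(H) = Gpd_H(εk) = Gpd_{H^e}(H) = r.Ggldim(H) = Gpd_{H^op}(k_ε), where H carries its regular H-bimodule structure. -/

import Mathlib

open TensorProduct

universe u

noncomputable section GorensteinCore

/-- `ProjDimLE R n M` : the left `R`-module `M` has a projective resolution of length `≤ n`. -/
def ProjDimLE (R : Type u) [Ring R] : ℕ → (M : Type u) → [AddCommGroup M] → [Module R M] → Prop
  | 0, M, _, _ => Module.Projective R M
  | (n+1), M, _, _ => Module.Projective R M ∨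
      ∃ (P : ModuleCat.{u} R) (f : P →ₗ[R] M), Module.Projective R P ∧
      Function.Surjective f ∧ ProjDimLE R n (LinearMap.ker f)

/-- The projective dimension of a module, as an element of `ℕ∞` (`⊤` = infinite). -/
def projDim (R : Type u) [Ring R] (M : Type u) [AddCommGroup M] [Module R M] : ℕ∞ :=
  sInf {n : ℕ∞ | ∃ m : ℕ, n = (m : ℕ∞) ∧ ProjDimLE R m M}

/-- A module is Gorenstein projective if it is a syzygy of a totally acyclic complex of
projective modules. -/
def IsGorensteinProjective (R : Type u) [Ring R] (M : Type u) [AddCommGroup M] [Module R M] :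
    Prop :=
  ∃ (P : ℤ → ModuleCat.{u} R) (d : ∀ i : ℤ, P (i+1) →ₗ[R] P i),
    (∀ i, Module.Projective R (P i)) ∧
    (∀ i, LinearMap.range (d (i+1)) = LinearMap.ker (d i)) ∧
    (∀ (Q : ModuleCat.{u} R), Module.Projective R Q →
      ∀ (i : ℤ) (f : P (i+1) →ₗ[R] Q), f.comp (d (i+1)) = 0 →
        ∃ g : P i →ₗ[R] Q, g.comp (d i) = f) ∧
    Nonempty (M ≃ₗ[R] LinearMap.ker (d 0))

/-- `GProjDimLE R n M` : `M` has a Gorenstein projective resolution of length `≤ n`. -/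
def GProjDimLE (R : Type u) [Ring R] : ℕ → (M : Type u) → [AddCommGroup M] → [Module R M] → Prop
  | 0, M, _, _ => IsGorensteinProjective R M
  | (n+1), M, _, _ => IsGorensteinProjective R M ∨
      ∃ (G : ModuleCat.{u} R) (f : G →ₗ[R] M), IsGorensteinProjective R G ∧
      Function.Surjective f ∧ GProjDimLE R n (LinearMap.ker f)

/-- The Gorenstein projective dimension of a module, as an element of `ℕ∞`. -/
def gProjDim (R : Type u) [Ring R] (M : Type u) [AddCommGroup M] [Module R M] : ℕ∞ :=
  sInf {n : ℕ∞ | ∃ m : ℕ, n = (m : ℕ∞) ∧ GProjDimLE R m M}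

/-- The (left) Gorenstein global dimension of a ring `R`. -/
def lGgldim (R : Type u) [Ring R] : ℕ∞ :=
  ⨆ M : ModuleCat.{u} R, gProjDim R M

/-- The (left) global dimension of a ring `R`. -/
def lgldim (R : Type u) [Ring R] : ℕ∞ :=
  ⨆ M : ModuleCat.{u} R, projDim R M

/-- `InjDimLE R n M` : the left `R`-module `M` has an injective resolution of length `≤ n`. -/
def InjDimLE (R : Type u) [Ring R] : ℕ → (M : Type u) → [AddCommGroup M] → [Module R M] → Prop
  | 0, M, _, _ => Module.Injective R M
  | (n+1), M, _, _ => Module.Injective R M ∨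
      ∃ (I : ModuleCat.{u} R) (f : M →ₗ[R] I), Module.Injective R I ∧
      Function.Injective f ∧ InjDimLE R n (I ⧸ LinearMap.range f)

/-- The injective dimension of a module, as an element of `ℕ∞`. -/
def injDim (R : Type u) [Ring R] (M : Type u) [AddCommGroup M] [Module R M] : ℕ∞ :=
  sInf {n : ℕ∞ | ∃ m : ℕ, n = (m : ℕ∞) ∧ InjDimLE R m M}

/-- `silp R` : the supremum of the injective dimensions of projective left `R`-modules. -/
def silp (R : Type u) [Ring R] : ℕ∞ :=
  ⨆ (M : ModuleCat.{u} R) (_ : Module.Projective R M), injDim R M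

/-- `spli R` : the supremum of the projective dimensions of injective left `R`-modules. -/
def spli (R : Type u) [Ring R] : ℕ∞ :=
  ⨆ (M : ModuleCat.{u} R) (_ : Module.Injective R M), projDim R M

end GorensteinCore
noncomputable section HopfCore

variable (k : Type u) [CommRing k] (H : Type u) [Ring H] [HopfAlgebra k H]

/-- The trivial left `H`-module structure on `k`, given by the counit. -/
def trivModule : Module H k :=
  Module.compHom k ((Bialgebra.counitAlgHom k H : H →ₐ[k] k) : H →+* k)

/-- The trivial left `H`-module `εk`, as an object of `ModuleCat H`. -/
def trivMod : ModuleCat.{u} H :=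
  @ModuleCat.of H _ k _ (trivModule k H)

/-- The counit of `H`, as a ring homomorphism out of `Hᵐᵒᵖ`. -/
def counitOp : Hᵐᵒᵖ →+* k :=
  RingHom.fromOpposite ((Bialgebra.counitAlgHom k H : H →ₐ[k] k) : H →+* k)
    (fun _ _ => mul_comm _ _)

/-- The trivial right `H`-module structure on `k` (as a left `Hᵐᵒᵖ`-module). -/
def trivModuleOp : Module Hᵐᵒᵖ k :=
  Module.compHom k (counitOp k H)

/-- The trivial right `H`-module `k_ε`, as an object of `ModuleCat Hᵐᵒᵖ`. -/
def trivModOp : ModuleCat.{u} Hᵐᵒᵖ :=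
  @ModuleCat.of Hᵐᵒᵖ _ k _ (trivModuleOp k H)

section TensorAction

variable (M N : Type u) [AddCommGroup M] [Module k M] [Module H M]
  [IsScalarTower k H M] [SMulCommClass k H M]
  [AddCommGroup N] [Module k N] [Module H N] [IsScalarTower k H N] [SMulCommClass k H N]

/-- The representation of `H` on a left `H`-module `M`, as an algebra morphism to
`End_k(M)`. -/
def hRep : H →ₐ[k] Module.End k M :=
  (Algebra.lsmul k k M : H →ₐ[k] Module.End k M)

/-- The representation of `H` on `M ⊗[k] N` given by the comultiplication of `H`:
`h • (m ⊗ n) = ∑ h₁ • m ⊗ h₂ • n`. -/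
def tensorRep : H →ₐ[k] Module.End k (M ⊗[k] N) :=
  ((Module.endTensorEndAlgHom (R := k) (S := k) (A := k) (M := M) (N := N)).comp
    (Algebra.TensorProduct.map (hRep k H M) (hRep k H N))).comp
    (Bialgebra.comulAlgHom k H)

/-- The diagonal left `H`-module structure on `M ⊗[k] N`:
`h • (m ⊗ n) = ∑ h₁ • m ⊗ h₂ • n`. -/
def tensorModule : Module H (M ⊗[k] N) :=
  Module.compHom (M ⊗[k] N)
    ((tensorRep k H M N).toRingHom : H →+* Module.End k (M ⊗[k] N))

/-- The tensor product `M ⊗[k] N` with its diagonal left `H`-module structure, as an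
object of `ModuleCat H`. -/
def tensorMod : ModuleCat.{u} H :=
  @ModuleCat.of H _ (M ⊗[k] N) _ (tensorModule k H M N)

end TensorAction

end HopfCore

/-- The scalar multiplication of an explicitly given module structure. -/
def modSMul {R M : Type u} [Semiring R] [AddCommMonoid M] (i : Module R M) (r : R) (m : M) : M :=
  letI := i; r • m

section ShortExactSequences

open CategoryTheory

variable {R : Type u} [Ring R]

/-- `f` and `g` form a short exact sequence of modules. -/
structure IsShortExact {A B C : Type u} [AddCommGroup A] [Module R A] [AddCommGroup B] [Module R B]
    [AddCommGroup C] [Module R C] (f : A →ₗ[R] B) (g : B →ₗ[R] C) : Prop where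
  inj : Function.Injective f
  exact : Function.Exact f g
  surj : Function.Surjective g

variable {A B C D E F X : Type u} [AddCommGroup A] [Module R A] [AddCommGroup B] [Module R B]
  [AddCommGroup C] [Module R C] [AddCommGroup D] [Module R D] [AddCommGroup E] [Module R E]
  [AddCommGroup F] [Module R F] [AddCommGroup X] [Module R X]

theorem LinearMap.exists_comp_eq_of_surjective (p : A →ₗ[R] B) (hp : Function.Surjective p)
    (f : A →ₗ[R] C) (h : ∀ a, p a = 0 → f a = 0) : ∃ g : B →ₗ[R] C, g ∘ₗ p = f := by
  refine ⟨(LinearMap.ker p).liftQ f h ∘ₗ (p.quotKerEquivOfSurjective hp).symm, ?_⟩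
  ext a
  have : (p.quotKerEquivOfSurjective hp).symm (p a) = (LinearMap.ker p).mkQ a := by
    rw [LinearEquiv.symm_apply_eq]; rfl
  simp only [LinearMap.comp_apply, LinearEquiv.coe_coe, this]
  rfl

theorem LinearMap.exists_comp_eq_of_injective (i : A →ₗ[R] B) (hi : Function.Injective i)
    (f : C →ₗ[R] B) (h : ∀ c, ∃ a, i a = f c) : ∃ g : C →ₗ[R] A, i ∘ₗ g = f := by
  refine ⟨(LinearEquiv.ofInjective i hi).symm ∘ₗ f.codRestrict (LinearMap.range i) h, ?_⟩
  ext c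
  exact congrArg Subtype.val
    ((LinearEquiv.ofInjective i hi).apply_symm_apply (f.codRestrict (LinearMap.range i) h c))

namespace IsShortExact

theorem comp_apply {f : A →ₗ[R] B} {g : B →ₗ[R] C} (h : IsShortExact f g) (a : A) :
    g (f a) = 0 := h.exact.apply_apply_eq_zero a

theorem mkQ_range (f : A →ₗ[R] B) (hf : Function.Injective f) :
    IsShortExact f (LinearMap.range f).mkQ :=
  ⟨hf, LinearMap.exact_map_mkQ_range f, Submodule.mkQ_surjective _⟩

theorem subtype_ker (g : A →ₗ[R] B) (hg : Function.Surjective g) :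
    IsShortExact (LinearMap.ker g).subtype g :=
  ⟨Subtype.val_injective, LinearMap.exact_subtype_ker_map g, hg⟩

theorem comp_equiv {f : A →ₗ[R] B} {g : B →ₗ[R] C} (h : IsShortExact f g) (e : C ≃ₗ[R] D) :
    IsShortExact f (e.toLinearMap ∘ₗ g) :=
  ⟨h.inj, fun b ↦ by simpa using h.exact b, e.surjective.comp h.surj⟩

theorem equiv_comp {f : A →ₗ[R] B} {g : B →ₗ[R] C} (h : IsShortExact f g) (e : D ≃ₗ[R] A) :
    IsShortExact (f ∘ₗ e.toLinearMap) g :=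
  ⟨h.inj.comp e.injective, fun b ↦ by
    rw [h.exact b]
    exact ⟨fun ⟨a, ha⟩ ↦ ⟨e.symm a, by simpa using ha⟩, fun ⟨d, hd⟩ ↦ ⟨e d, hd⟩⟩, h.surj⟩

/-- The kernel of the second map of a short exact sequence is the first term. -/
theorem nonempty_equiv_ker {f : A →ₗ[R] B} {g : B →ₗ[R] C} (h : IsShortExact f g) :
    Nonempty (A ≃ₗ[R] LinearMap.ker g) :=
  ⟨(LinearEquiv.ofInjective f h.inj).trans
    (LinearEquiv.ofEq _ _ h.exact.linearMap_ker_eq.symm)⟩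

theorem exists_retraction {f : A →ₗ[R] B} {g : B →ₗ[R] C} (h : IsShortExact f g)
    [Module.Projective R C] : ∃ r : B →ₗ[R] A, r ∘ₗ f = LinearMap.id := by
  obtain ⟨s, hs⟩ := Module.projective_lifting_property g LinearMap.id h.surj
  obtain ⟨r, hr⟩ := LinearMap.exists_comp_eq_of_injective f h.inj (LinearMap.id - s ∘ₗ g)
    fun b ↦ (h.exact _).1 (by
      have := LinearMap.congr_fun hs (g b)
      simp only [LinearMap.comp_apply, LinearMap.id_apply] at this
      simp [this])
  refine ⟨r, LinearMap.ext fun a ↦ h.inj ?_⟩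
  have := LinearMap.congr_fun hr (f a)
  simpa [h.comp_apply] using this

theorem exists_pushout {i : A →ₗ[R] B} {p : B →ₗ[R] C} (h : IsShortExact i p)
    {j : A →ₗ[R] D} {q : D →ₗ[R] E} (h' : IsShortExact j q) :
    ∃ (X : ModuleCat.{u} R) (a : B →ₗ[R] X) (a' : X →ₗ[R] E) (b : D →ₗ[R] X) (b' : X →ₗ[R] C),
      IsShortExact a a' ∧ IsShortExact b b' := by
  let N := LinearMap.range (i.prod (-j))
  have hN : ∀ x y, N.mkQ (x, y) = 0 ↔ ∃ a, i a = x ∧ -j a = y := by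
    intro x y
    rw [Submodule.mkQ_apply, Submodule.Quotient.mk_eq_zero]
    simp [N, Prod.ext_iff]
  obtain ⟨a', ha'⟩ := LinearMap.exists_comp_eq_of_surjective N.mkQ N.mkQ_surjective
    (q ∘ₗ LinearMap.snd R B D) (by
      rintro ⟨x, y⟩ hxy
      obtain ⟨a, rfl, rfl⟩ := (hN x y).1 hxy
      simp [h'.comp_apply])
  obtain ⟨b', hb'⟩ := LinearMap.exists_comp_eq_of_surjective N.mkQ N.mkQ_surjective
    (p ∘ₗ LinearMap.fst R B D) (by
      rintro ⟨x, y⟩ hxy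
      obtain ⟨a, rfl, rfl⟩ := (hN x y).1 hxy
      simp [h.comp_apply])
  have ha (x) : a' (N.mkQ x) = q x.2 := LinearMap.congr_fun ha' x
  have hb (x) : b' (N.mkQ x) = p x.1 := LinearMap.congr_fun hb' x
  refine ⟨ModuleCat.of R (_ ⧸ N), N.mkQ ∘ₗ LinearMap.inl R B D, a', N.mkQ ∘ₗ LinearMap.inr R B D,
    b', ⟨?_, ?_, ?_⟩, ⟨?_, ?_, ?_⟩⟩
  · rw [injective_iff_map_eq_zero]
    intro x hx
    obtain ⟨a, rfl, h0⟩ := (hN _ _).1 hx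
    have : a = 0 := h'.inj (by simpa using h0)
    simp [this]
  · intro z
    obtain ⟨⟨x, y⟩, rfl⟩ := N.mkQ_surjective z
    rw [ha]
    constructor
    · intro hy
      obtain ⟨a, rfl⟩ := (h'.exact y).1 hy
      refine ⟨x + i a, ?_⟩
      simp only [LinearMap.comp_apply, LinearMap.inl_apply]
      rw [← sub_eq_zero, ← map_sub]
      exact (hN _ _).2 ⟨a, by simp, by simp⟩
    · rintro ⟨x', hx'⟩
      have := congrArg a' hx'
      simp only [LinearMap.comp_apply, LinearMap.inl_apply] at this
      rw [ha, ha] at this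
      simpa using this.symm
  · intro e
    obtain ⟨y, rfl⟩ := h'.surj e
    exact ⟨N.mkQ (0, y), ha _⟩
  · rw [injective_iff_map_eq_zero]
    intro y hy
    obtain ⟨a, h0, rfl⟩ := (hN _ _).1 hy
    have : a = 0 := h.inj (by simpa using h0)
    simp [this]
  · intro z
    obtain ⟨⟨x, y⟩, rfl⟩ := N.mkQ_surjective z
    rw [hb]
    constructor
    · intro hx
      obtain ⟨a, rfl⟩ := (h.exact x).1 hx
      refine ⟨y + j a, ?_⟩
      simp only [LinearMap.comp_apply, LinearMap.inr_apply]
      rw [← sub_eq_zero, ← map_sub]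
      exact (hN _ _).2 ⟨-a, by simp, by simp⟩
    · rintro ⟨x', hx'⟩
      have := congrArg b' hx'
      simp only [LinearMap.comp_apply, LinearMap.inr_apply] at this
      rw [hb, hb] at this
      simpa using this.symm
  · intro c
    obtain ⟨x, rfl⟩ := h.surj c
    exact ⟨N.mkQ (x, 0), hb _⟩

/-- The third isomorphism theorem: for `A ⊆ B ⊆ D`, the sequence `B/A → D/A → D/B` is exact. -/
theorem exists_quotient {i : A →ₗ[R] B} {p : B →ₗ[R] C} (h : IsShortExact i p)
    {j : B →ₗ[R] D} {q : D →ₗ[R] E} (h' : IsShortExact j q) :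
    ∃ (X : ModuleCat.{u} R) (π : D →ₗ[R] X) (a : C →ₗ[R] X) (b : X →ₗ[R] E),
      IsShortExact (j ∘ₗ i) π ∧ IsShortExact a b := by
  have hπ := mkQ_range (j ∘ₗ i) (h'.inj.comp h.inj)
  set π := (LinearMap.range (j ∘ₗ i)).mkQ
  obtain ⟨a, ha⟩ := LinearMap.exists_comp_eq_of_surjective p h.surj (π ∘ₗ j) (by
    intro x hx
    obtain ⟨y, rfl⟩ := (h.exact x).1 hx
    exact hπ.comp_apply y)
  obtain ⟨b, hb⟩ := LinearMap.exists_comp_eq_of_surjective π hπ.surj q (by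
    intro x hx
    obtain ⟨y, rfl⟩ := (hπ.exact x).1 hx
    exact h'.comp_apply _)
  replace ha (x) : a (p x) = π (j x) := LinearMap.congr_fun ha x
  replace hb (x) : b (π x) = q x := LinearMap.congr_fun hb x
  refine ⟨ModuleCat.of R (D ⧸ LinearMap.range (j ∘ₗ i)), π, a, b, hπ, ?_, ?_, ?_⟩
  · rw [injective_iff_map_eq_zero]
    intro c hc
    obtain ⟨x, rfl⟩ := h.surj c
    rw [ha] at hc
    obtain ⟨y, hy⟩ := (hπ.exact _).1 hc
    rw [← h'.inj hy, h.comp_apply]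
  · intro z
    obtain ⟨x, rfl⟩ := hπ.surj z
    rw [hb]
    constructor
    · intro hx
      obtain ⟨y, rfl⟩ := (h'.exact x).1 hx
      exact ⟨p y, ha y⟩
    · rintro ⟨c, hc⟩
      obtain ⟨y, rfl⟩ := h.surj c
      rw [ha] at hc
      rw [← hb, ← hc, hb, h'.comp_apply]
  · intro e
    obtain ⟨x, rfl⟩ := h'.surj e
    exact ⟨π x, hb x⟩

/-- A horseshoe: embeddings of the outer terms of a short exact sequence, the first of which
extends to the middle term, give an embedding of the middle term. -/
theorem exists_horseshoe {i : A →ₗ[R] B} {p : B →ₗ[R] C} (h : IsShortExact i p)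
    {D' F' : Type u} [AddCommGroup D'] [Module R D'] [AddCommGroup F'] [Module R F']
    {j : A →ₗ[R] D} {q : D →ₗ[R] D'} (hA : IsShortExact j q)
    {k : C →ₗ[R] F} {l : F →ₗ[R] F'} (hC : IsShortExact k l)
    (t : B →ₗ[R] D) (ht : t ∘ₗ i = j) :
    ∃ (X : ModuleCat.{u} R) (π : D × F →ₗ[R] X) (a : D' →ₗ[R] X) (b : X →ₗ[R] F'),
      IsShortExact (t.prod (k ∘ₗ p)) π ∧ IsShortExact a b := by
  replace ht (x) : t (i x) = j x := LinearMap.congr_fun ht x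
  have hinj : Function.Injective (t.prod (k ∘ₗ p)) := by
    rw [injective_iff_map_eq_zero]
    intro x hx
    replace hx : t x = 0 ∧ k (p x) = 0 := Prod.mk.inj hx
    obtain ⟨y, rfl⟩ := (h.exact x).1 (hC.inj (by simpa using hx.2))
    rw [ht] at hx
    rw [hA.inj (hx.1.trans (map_zero j).symm), map_zero]
  have hπ := mkQ_range _ hinj
  set π := (LinearMap.range (t.prod (k ∘ₗ p))).mkQ
  obtain ⟨a, ha⟩ := LinearMap.exists_comp_eq_of_surjective q hA.surj
    (π ∘ₗ LinearMap.inl R D F) (by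
      intro x hx
      obtain ⟨y, rfl⟩ := (hA.exact x).1 hx
      have := hπ.comp_apply (i y)
      simpa [ht, h.comp_apply] using this)
  obtain ⟨b, hb⟩ := LinearMap.exists_comp_eq_of_surjective π hπ.surj
    (l ∘ₗ LinearMap.snd R D F) (by
      intro x hx
      obtain ⟨y, rfl⟩ := (hπ.exact x).1 hx
      simp [hC.comp_apply])
  replace ha (x) : a (q x) = π (x, 0) := LinearMap.congr_fun ha x
  replace hb (x) : b (π x) = l x.2 := LinearMap.congr_fun hb x
  refine ⟨ModuleCat.of R (_ ⧸ LinearMap.range (t.prod (k ∘ₗ p))), π, a, b, hπ, ?_, ?_, ?_⟩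
  · rw [injective_iff_map_eq_zero]
    intro c hc
    obtain ⟨x, rfl⟩ := hA.surj c
    rw [ha] at hc
    obtain ⟨y, hy⟩ := (hπ.exact _).1 hc
    replace hy : t y = x ∧ k (p y) = 0 := Prod.mk.inj hy
    obtain ⟨z, rfl⟩ := (h.exact y).1 (hC.inj (by simpa using hy.2))
    rw [← hy.1, ht, hA.comp_apply]
  · intro z
    obtain ⟨⟨x, y⟩, rfl⟩ := hπ.surj z
    rw [hb]
    constructor
    · intro hy
      obtain ⟨c, rfl⟩ := (hC.exact y).1 hy
      obtain ⟨b, rfl⟩ := h.surj c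
      refine ⟨q (x - t b), ?_⟩
      rw [ha, ← sub_eq_zero, ← map_sub]
      refine (hπ.exact _).2 ⟨-b, ?_⟩
      simp
    · rintro ⟨c, hc⟩
      obtain ⟨w, rfl⟩ := hA.surj c
      rw [ha] at hc
      have := congrArg b hc
      rw [hb, hb] at this
      simpa using this.symm
  · intro e
    obtain ⟨x, rfl⟩ := hC.surj e
    exact ⟨π (0, x), hb _⟩

/-- A short exact sequence of modules as a short complex in the category of modules. -/
theorem exists_shortComplex {A B C : ModuleCat.{u} R} {f : A →ₗ[R] B} {g : B →ₗ[R] C}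
    (h : IsShortExact f g) : ∃ S : ShortComplex (ModuleCat.{u} R),
      S.ShortExact ∧ S.X₁ = A ∧ S.X₂ = B ∧ S.X₃ = C :=
  ⟨ModuleCat.shortComplexOfCompEqZero f g (LinearMap.ext h.comp_apply),
    ModuleCat.shortComplex_shortExact _ h.exact h.inj h.surj, rfl, rfl, rfl⟩

theorem hasProjectiveDimensionLT_X₃ {A B C : ModuleCat.{u} R} {f : A →ₗ[R] B} {g : B →ₗ[R] C}
    (h : IsShortExact f g) (n : ℕ) (hA : HasProjectiveDimensionLT A n)
    (hB : HasProjectiveDimensionLT B (n + 1)) : HasProjectiveDimensionLT C (n + 1) := by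
  obtain ⟨S, hS, rfl, rfl, rfl⟩ := h.exists_shortComplex
  exact hS.hasProjectiveDimensionLT_X₃ n hA hB

theorem hasProjectiveDimensionLT_X₁ {A B C : ModuleCat.{u} R} {f : A →ₗ[R] B} {g : B →ₗ[R] C}
    (h : IsShortExact f g) (n : ℕ) (hB : HasProjectiveDimensionLT B n)
    (hC : HasProjectiveDimensionLT C (n + 1)) : HasProjectiveDimensionLT A n := by
  obtain ⟨S, hS, rfl, rfl, rfl⟩ := h.exists_shortComplex
  exact hS.hasProjectiveDimensionLT_X₁ n hB hC

end IsShortExact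

theorem hasProjectiveDimensionLT_one_iff (M : ModuleCat.{u} R) :
    HasProjectiveDimensionLT M 1 ↔ Module.Projective R M := by
  rw [← projective_iff_hasProjectiveDimensionLT_one, ← IsProjective.iff_projective]

theorem exists_isShortExact_of_projective (M : ModuleCat.{u} R) :
    ∃ (K P : ModuleCat.{u} R) (i : K →ₗ[R] P) (p : P →ₗ[R] M),
      Module.Projective R P ∧ IsShortExact i p :=
  ⟨ModuleCat.of R _, ModuleCat.of R (M →₀ R), _, Finsupp.linearCombination R id,
    inferInstanceAs (Module.Projective R (M →₀ R)),
    .subtype_ker _ (Finsupp.linearCombination_id_surjective R M)⟩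

end ShortExactSequences

section GorensteinProjective

open CategoryTheory

variable {R : Type u} [Ring R]

/-- `Ext¹(L, Q) = 0` for all projective modules `Q`, phrased as an extension property. -/
def ExtVanishes (L : ModuleCat.{u} R) : Prop :=
  ∀ (A B Q : ModuleCat.{u} R) (i : A →ₗ[R] B) (p : B →ₗ[R] L), IsShortExact i p →
    Module.Projective R Q → ∀ t : A →ₗ[R] Q, ∃ s : B →ₗ[R] Q, s ∘ₗ i = t

/-- `M` embeds into a projective module with cokernel satisfying `C`. -/
def EmbedsInProjective (C : ModuleCat.{u} R → Prop) (M : ModuleCat.{u} R) : Prop :=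
  ∃ (Q N : ModuleCat.{u} R) (i : M →ₗ[R] Q) (p : Q →ₗ[R] N),
    Module.Projective R Q ∧ IsShortExact i p ∧ C N

/-- `M` is a quotient of a projective module by a module satisfying `C`. -/
def CoveredByProjective (C : ModuleCat.{u} R → Prop) (M : ModuleCat.{u} R) : Prop :=
  ∃ (N Q : ModuleCat.{u} R) (i : N →ₗ[R] Q) (p : Q →ₗ[R] M),
    Module.Projective R Q ∧ IsShortExact i p ∧ C N

/-- `M` has a coresolution by projectives all of whose cosyzygies are left `Ext¹`-orthogonal
to projectives. -/
def HasProjectiveCoresolution (M : ModuleCat.{u} R) : Prop :=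
  ∃ C : ModuleCat.{u} R → Prop, C M ∧ ∀ N, C N → ExtVanishes N ∧ EmbedsInProjective C N

namespace ExtVanishes

theorem of_projective (L : ModuleCat.{u} R) [Module.Projective R L] : ExtVanishes L := by
  intro A B Q i p h _ t
  obtain ⟨r, hr⟩ := h.exists_retraction
  exact ⟨t ∘ₗ r, by rw [LinearMap.comp_assoc, hr, LinearMap.comp_id]⟩

theorem of_equiv {L L' : ModuleCat.{u} R} (e : L ≃ₗ[R] L') (h : ExtVanishes L) :
    ExtVanishes L' := fun A B Q i _ hip hQ t ↦ h A B Q i _ (hip.comp_equiv e.symm) hQ t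

/-- The vanishing of `Ext¹(L, -)` on projectives can be tested on one surjection `π` from a
projective module onto `L`, whose kernel is the image of `δ`. -/
theorem of_presentation {L P T : ModuleCat.{u} R} [Module.Projective R P] [Module.Projective R T]
    (π : P →ₗ[R] L) (hπ : Function.Surjective π) (δ : T →ₗ[R] P) (hδ : Function.Exact δ π)
    (h : ∀ (Q : ModuleCat.{u} R), Module.Projective R Q → ∀ f : T →ₗ[R] Q,
      (∀ x, δ x = 0 → f x = 0) → ∃ g : P →ₗ[R] Q, g ∘ₗ δ = f) : ExtVanishes L := by
  intro A B Q i p hip hQ t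
  obtain ⟨φ, hφ⟩ := Module.projective_lifting_property p π hip.surj
  replace hφ (x) : p (φ x) = π x := LinearMap.congr_fun hφ x
  obtain ⟨ψ, hψ⟩ := LinearMap.exists_comp_eq_of_injective i hip.inj (φ ∘ₗ δ) fun x ↦
    (hip.exact _).1 (by rw [LinearMap.comp_apply, hφ, hδ.apply_apply_eq_zero])
  replace hψ (x) : i (ψ x) = φ (δ x) := LinearMap.congr_fun hψ x
  obtain ⟨g, hg⟩ := h Q hQ (t ∘ₗ ψ) fun x hx ↦ by
    have : ψ x = 0 := hip.inj (by rw [hψ, hx, map_zero, map_zero])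
    simp [this]
  replace hg (x) : g (δ x) = t (ψ x) := LinearMap.congr_fun hg x
  obtain ⟨s, hs⟩ := LinearMap.exists_comp_eq_of_surjective (φ.coprod i) (by
    intro b
    obtain ⟨x, hx⟩ := hπ (p b)
    obtain ⟨a, ha⟩ := (hip.exact (b - φ x)).1 (by rw [map_sub, hφ, hx, sub_self])
    exact ⟨(x, a), by simp [ha]⟩) (g.coprod t) (by
    rintro ⟨x, a⟩ hxa
    rw [LinearMap.coprod_apply] at hxa ⊢
    have hx : π x = 0 := by
      rw [← hφ]
      simpa [hip.comp_apply] using congrArg p hxa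
    obtain ⟨y, rfl⟩ := (hδ x).1 hx
    have : ψ y + a = 0 := hip.inj (by rw [map_add, hψ, hxa, map_zero])
    rw [hg, ← map_add, this, map_zero])
  refine ⟨s, LinearMap.ext fun a ↦ ?_⟩
  simpa using LinearMap.congr_fun hs (0, a)

theorem of_isShortExact {A E B : ModuleCat.{u} R} {i : A →ₗ[R] E} {p : E →ₗ[R] B}
    (h : IsShortExact i p) (hA : ExtVanishes A) (hB : ExtVanishes B) : ExtVanishes E := by
  intro X Y Q j q hjq hQ t
  -- pull back along `A → E`: the preimage of `A` in `Y` is an extension of `A` by `X`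
  have hsurj : Function.Surjective (p ∘ₗ q) := h.surj.comp hjq.surj
  have hK := IsShortExact.subtype_ker (p ∘ₗ q) hsurj
  obtain ⟨j', hj'⟩ := LinearMap.exists_comp_eq_of_injective (LinearMap.ker (p ∘ₗ q)).subtype
    Subtype.val_injective j fun x ↦ ⟨⟨j x, by simp [hjq.comp_apply]⟩, rfl⟩
  obtain ⟨q', hq'⟩ := LinearMap.exists_comp_eq_of_injective i h.inj
    (q ∘ₗ (LinearMap.ker (p ∘ₗ q)).subtype) fun x ↦ (h.exact _).1 x.2
  replace hj' (x) : (j' x : Y) = j x := LinearMap.congr_fun hj' x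
  replace hq' (x) : i (q' x) = q x := LinearMap.congr_fun hq' x
  obtain ⟨s, hs⟩ := hA X (ModuleCat.of R (LinearMap.ker (p ∘ₗ q))) Q j' q' ⟨fun x y hxy ↦
      hjq.inj (by rw [← hj', ← hj', hxy]), fun y ↦ by
        rw [← h.inj.eq_iff, hq', map_zero, hjq.exact]
        exact ⟨fun ⟨x, hx⟩ ↦ ⟨x, Subtype.ext ((hj' x).trans hx)⟩,
          fun ⟨x, hx⟩ ↦ ⟨x, by rw [← hj', hx]⟩⟩, fun a ↦ by
        obtain ⟨y, hy⟩ := hjq.surj (i a)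
        exact ⟨⟨y, by simp [hy, h.comp_apply]⟩, h.inj (by rw [hq', hy])⟩⟩ hQ t
  obtain ⟨s', hs'⟩ := hB (ModuleCat.of R (LinearMap.ker (p ∘ₗ q))) Y Q _ _ hK hQ s
  refine ⟨s', LinearMap.ext fun x ↦ ?_⟩
  rw [← hs, ← hs']
  simp [hj']

end ExtVanishes

theorem HasProjectiveCoresolution.embedsInProjective {M : ModuleCat.{u} R}
    (h : HasProjectiveCoresolution M) : EmbedsInProjective HasProjectiveCoresolution M := by
  obtain ⟨C, hM, hC⟩ := h
  obtain ⟨-, Q, N, i, p, hQ, hip, hN⟩ := hC M hM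
  exact ⟨Q, N, i, p, hQ, hip, C, hN, hC⟩

theorem HasProjectiveCoresolution.extVanishes {M : ModuleCat.{u} R}
    (h : HasProjectiveCoresolution M) : ExtVanishes M :=
  let ⟨_, hM, hC⟩ := h
  (hC M hM).1

theorem HasProjectiveCoresolution.of_isShortExact {A E B : ModuleCat.{u} R} {i : A →ₗ[R] E}
    {p : E →ₗ[R] B} (h : IsShortExact i p) (hA : HasProjectiveCoresolution A)
    (hB : HasProjectiveCoresolution B) : HasProjectiveCoresolution E := by
  refine ⟨fun E ↦ ∃ (A B : ModuleCat.{u} R) (i : A →ₗ[R] E) (p : E →ₗ[R] B), IsShortExact i p ∧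
    HasProjectiveCoresolution A ∧ HasProjectiveCoresolution B, ⟨A, B, i, p, h, hA, hB⟩, ?_⟩
  clear! A B E
  rintro E ⟨A, B, i, p, h, hA, hB⟩
  refine ⟨.of_isShortExact h hA.extVanishes hB.extVanishes, ?_⟩
  obtain ⟨QA, A', j, q, hQA, hjq, hA'⟩ := hA.embedsInProjective
  obtain ⟨QB, B', k, l, hQB, hkl, hB'⟩ := hB.embedsInProjective
  obtain ⟨t, ht⟩ := hB.extVanishes A E QA i p h hQA j
  obtain ⟨X, π, a, b, hX, hab⟩ := h.exists_horseshoe hjq hkl t ht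
  exact ⟨ModuleCat.of R (QA × QB), X, _, π, inferInstanceAs (Module.Projective R (QA × QB)), hX,
    A', B', a, b, hab, hA', hB'⟩

theorem IsGorensteinProjective.hasProjectiveCoresolution {M : ModuleCat.{u} R}
    (h : IsGorensteinProjective R M) : HasProjectiveCoresolution M := by
  obtain ⟨P, d, hP, hd, hQ, ⟨e⟩⟩ := h
  have hex (i : ℤ) (x) : d i (d (i + 1) x) = 0 :=
    LinearMap.mem_ker.1 (hd i ▸ LinearMap.mem_range_self _ x)
  have key (i : ℤ) : ∃ π : P (i + 1 + 1) →ₗ[R] LinearMap.ker (d i), IsShortExact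
      (LinearMap.ker (d (i + 1))).subtype π ∧ ∀ x, (π x : P (i + 1)) = d (i + 1) x := by
    refine ⟨(d (i + 1)).codRestrict _ fun x ↦ hex i x, ⟨Subtype.val_injective, fun x ↦ ?_, ?_⟩,
      fun _ ↦ rfl⟩
    · rw [Subtype.ext_iff]
      exact ⟨fun h ↦ ⟨⟨x, h⟩, rfl⟩, by rintro ⟨y, rfl⟩; exact y.2⟩
    · rintro ⟨x, hx⟩
      rw [← hd] at hx
      obtain ⟨y, rfl⟩ := hx
      exact ⟨y, rfl⟩
  refine ⟨fun N ↦ ∃ i : ℤ, Nonempty (N ≃ₗ[R] LinearMap.ker (d i)), ⟨0, ⟨e⟩⟩, ?_⟩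
  rintro N ⟨i, ⟨e'⟩⟩
  constructor
  · refine .of_equiv (L := ModuleCat.of R (LinearMap.ker (d i))) e'.symm ?_
    obtain ⟨π, hπ, hπd⟩ := key i
    refine .of_presentation (P := P (i + 1 + 1)) (T := P (i + 1 + 1 + 1)) π hπ.surj
      (d (i + 1 + 1)) (fun x ↦ ?_) fun Q hQ' f hf ↦ hQ Q hQ' _ f (LinearMap.ext fun x ↦ ?_)
    · rw [← ZeroMemClass.coe_eq_zero, hπd, ← LinearMap.mem_ker, ← hd]
      rfl
    · exact hf _ (hex _ x)
  · obtain ⟨i, rfl⟩ : ∃ j, i = j + 1 := ⟨i - 1, by omega⟩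
    obtain ⟨π, hπ, -⟩ := key i
    exact ⟨P (i + 1 + 1), ModuleCat.of R (LinearMap.ker (d i)), _, π, hP _, hπ.equiv_comp e', i,
      ⟨LinearEquiv.refl R _⟩⟩

/-- A relation which can be continued in both directions on a predicate `C` admits two-sided
chains. -/
theorem exists_int_chain {α : Type*} (C : α → Prop) (r : α → α → Prop)
    (hl : ∀ x, C x → ∃ y, C y ∧ r y x) (hr : ∀ x, C x → ∃ y, C y ∧ r x y) (x : α) (hx : C x)
    (j : ℤ) : ∃ f : ℤ → α, f j = x ∧ ∀ i, C (f i) ∧ r (f (i + 1)) (f i) := by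
  choose l hl hl' using hl
  choose s hs hs' using hr
  let L : ℕ → {x // C x} := fun n ↦ (fun y ↦ ⟨l y.1 y.2, hl y.1 y.2⟩)^[n] ⟨x, hx⟩
  let S : ℕ → {x // C x} := fun n ↦ (fun y ↦ ⟨s y.1 y.2, hs y.1 y.2⟩)^[n] ⟨x, hx⟩
  have hL (n) : r (L (n + 1)).1 (L n).1 := by
    simp only [L, Function.iterate_succ_apply']
    exact hl' _ _
  have hS (n) : r (S n).1 (S (n + 1)).1 := by
    simp only [S, Function.iterate_succ_apply']
    exact hs' _ _
  let f : ℤ → {x // C x} := fun i ↦ if 0 ≤ i then L i.toNat else S (-i).toNat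
  have hf (i : ℤ) : r (f (i + 1)).1 (f i).1 := by
    rcases le_or_gt 0 i with h | h
    · have h' : 0 ≤ i + 1 := by omega
      have : (i + 1).toNat = i.toNat + 1 := by omega
      simpa only [f, h, h', if_true, this] using hL i.toNat
    · have hf' : f (i + 1) = S (-(i + 1)).toNat := by
        by_cases h' : 0 ≤ i + 1
        · obtain rfl : i = -1 := by omega
          rfl
        · simp [f, h']
      have : (-i).toNat = (-(i + 1)).toNat + 1 := by omega
      rw [hf']
      simpa only [f, not_le.2 h, if_false, this] using hS (-(i + 1)).toNat
  refine ⟨fun i ↦ f (i - j), by simp [f, L], fun i ↦ ⟨(f _).2, ?_⟩⟩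
  simpa only [show i + 1 - j = i - j + 1 by ring] using hf (i - j)

/-- A coinductive criterion for Gorenstein projectivity. -/
theorem isGorensteinProjective_of_class (C : ModuleCat.{u} R → Prop)
    (hC : ∀ N, C N → ExtVanishes N ∧ EmbedsInProjective C N ∧ CoveredByProjective C N)
    (M : ModuleCat.{u} R) (hM : C M) : IsGorensteinProjective R M := by
  obtain ⟨Z, hZ, h⟩ := exists_int_chain C (fun X Y ↦ ∃ (P : ModuleCat.{u} R) (i : X →ₗ[R] P)
      (p : P →ₗ[R] Y), Module.Projective R P ∧ IsShortExact i p)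
    (fun Y hY ↦ by
      obtain ⟨-, -, X, P, i, p, hP, hip, hX⟩ := hC Y hY
      exact ⟨X, hX, P, i, p, hP, hip⟩)
    (fun X hX ↦ by
      obtain ⟨-, ⟨P, Y, i, p, hP, hip, hY⟩, -⟩ := hC X hX
      exact ⟨Y, hY, P, i, p, hP, hip⟩) M hM (0 + 1 + 1)
  choose hCZ P ι π hP hιπ using h
  refine ⟨P, fun i ↦ ι i ∘ₗ π (i + 1), hP, fun i ↦ ?_, fun Q hQ i f hf ↦ ?_, ?_⟩
  · rw [LinearMap.range_comp, LinearMap.range_eq_top.2 (hιπ _).surj, Submodule.map_top,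
      LinearMap.ker_comp, LinearMap.ker_eq_bot.2 (hιπ _).inj, Submodule.comap_bot]
    exact (hιπ (i + 1)).exact.linearMap_ker_eq.symm
  · obtain ⟨f', rfl⟩ := LinearMap.exists_comp_eq_of_surjective (π (i + 1)) (hιπ _).surj f
      fun x hx ↦ by
        obtain ⟨y, rfl⟩ := ((hιπ _).exact x).1 hx
        obtain ⟨z, rfl⟩ := (hιπ (i + 1 + 1)).surj y
        exact LinearMap.congr_fun hf z
    obtain ⟨g, rfl⟩ := (hC _ (hCZ i)).1 _ _ Q _ _ (hιπ i) hQ f'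
    exact ⟨g, rfl⟩
  · subst hZ
    obtain ⟨e⟩ := (hιπ (0 + 1)).nonempty_equiv_ker
    refine ⟨e.trans (LinearEquiv.ofEq _ _ ?_)⟩
    rw [LinearMap.ker_comp, LinearMap.ker_eq_bot.2 (hιπ _).inj, Submodule.comap_bot]

theorem IsGorensteinProjective.of_projective (M : ModuleCat.{u} R) (hM : Module.Projective R M) :
    IsGorensteinProjective R M := by
  refine isGorensteinProjective_of_class (fun N ↦ Module.Projective R N) (fun N hN ↦
    ⟨.of_projective N, ?_, ?_⟩) M hM
  · exact ⟨N, ModuleCat.of R PUnit.{u + 1}, LinearMap.id, 0, hN, ⟨Function.injective_id, fun x ↦ by simp,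
      fun _ ↦ ⟨0, rfl⟩⟩, inferInstanceAs (Module.Projective R PUnit.{u + 1})⟩
  · refine ⟨ModuleCat.of R PUnit.{u + 1}, N, 0, LinearMap.id, hN, ⟨fun _ _ _ ↦ rfl, fun x ↦ ?_,
      Function.surjective_id⟩, inferInstanceAs (Module.Projective R PUnit.{u + 1})⟩
    simp [eq_comm]

theorem IsGorensteinProjective.of_equiv {M N : Type u} [AddCommGroup M] [Module R M]
    [AddCommGroup N] [Module R N] (e : M ≃ₗ[R] N) (h : IsGorensteinProjective R M) :
    IsGorensteinProjective R N := by
  obtain ⟨P, d, h₁, h₂, h₃, ⟨f⟩⟩ := h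
  exact ⟨P, d, h₁, h₂, h₃, ⟨e.symm.trans f⟩⟩

theorem GProjDimLE.of_equiv {n : ℕ} {M N : Type u} [AddCommGroup M] [Module R M]
    [AddCommGroup N] [Module R N] (e : M ≃ₗ[R] N) (h : GProjDimLE R n M) :
    GProjDimLE R n N := by
  induction n generalizing M N with
  | zero => exact IsGorensteinProjective.of_equiv e h
  | succ n ih =>
    obtain h | ⟨G, f, hG, hf, hK⟩ := h
    · exact .inl (.of_equiv e h)
    · exact .inr ⟨G, e.toLinearMap ∘ₗ f, hG, e.surjective.comp hf,
        ih (LinearEquiv.ofEq _ _ (by rw [LinearEquiv.ker_comp])) hK⟩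

/-- A module of Gorenstein projective dimension at most `n` embeds into a module of projective
dimension at most `n`, with cokernel as for a Gorenstein projective module. -/
theorem GProjDimLE.exists_embedding (n : ℕ) (M : ModuleCat.{u} R) (h : GProjDimLE R n M) :
    ∃ (Λ L : ModuleCat.{u} R) (i : M →ₗ[R] Λ) (p : Λ →ₗ[R] L), IsShortExact i p ∧
      HasProjectiveDimensionLT Λ (n + 1) ∧ HasProjectiveCoresolution L := by
  have hGP (n : ℕ) (M : ModuleCat.{u} R) (h : IsGorensteinProjective R M) :
      ∃ (Λ L : ModuleCat.{u} R) (i : M →ₗ[R] Λ) (p : Λ →ₗ[R] L), IsShortExact i p ∧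
        HasProjectiveDimensionLT Λ (n + 1) ∧ HasProjectiveCoresolution L := by
    obtain ⟨Q, N, i, p, hQ, hip, hN⟩ := h.hasProjectiveCoresolution.embedsInProjective
    have := (hasProjectiveDimensionLT_one_iff Q).2 hQ
    exact ⟨Q, N, i, p, hip, hasProjectiveDimensionLT_of_ge Q 1 _ (by omega), hN⟩
  induction n generalizing M with
  | zero => exact hGP 0 M h
  | succ n ih =>
    obtain h | ⟨G, f, hG, hf, hK⟩ := h
    · exact hGP _ M h
    obtain ⟨Λ, L, i, p, hip, hΛ, hL⟩ := ih (ModuleCat.of R (LinearMap.ker f)) hK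
    obtain ⟨X, a, a', b, b', ha, hb⟩ := (IsShortExact.subtype_ker f hf).exists_pushout hip
    obtain ⟨Q, E, j, q, hQ, hjq, hE⟩ :=
      (HasProjectiveCoresolution.of_isShortExact ha hG.hasProjectiveCoresolution
        hL).embedsInProjective
    obtain ⟨Λ', π, c, c', hπ, hc⟩ := hb.exists_quotient hjq
    have := (hasProjectiveDimensionLT_one_iff Q).2 hQ
    exact ⟨Λ', E, c, c', hc, hπ.hasProjectiveDimensionLT_X₃ _ hΛ
      (hasProjectiveDimensionLT_of_ge Q 1 _ (by omega)), hE⟩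

end GorensteinProjective

section Shear

variable {k : Type u} [CommRing k] {H : Type u} [AddCommGroup H] [Module k H]
  {W : Type u} [AddCommGroup W] [Module k W]

/-- Given a comultiplication `c` on `H` and a family `A` of endomorphisms of `W`, the map
`h ⊗ w ↦ ∑ h₁ ⊗ A h₂ w`. -/
def shear (c : H →ₗ[k] H ⊗[k] H) (A : H →ₗ[k] Module.End k W) : Module.End k (H ⊗[k] W) :=
  (TensorProduct.lift A).lTensor H ∘ₗ (TensorProduct.assoc k H H W).toLinearMap ∘ₗ c.rTensor W

theorem shear_tmul (c : H →ₗ[k] H ⊗[k] H) (A : H →ₗ[k] Module.End k W) (h : H) (w : W) :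
    shear c A (h ⊗ₜ w) = (A.flip w).lTensor H (c h) := by
  simp only [shear, LinearMap.comp_apply, LinearMap.rTensor_tmul]
  generalize c h = x
  induction x with
  | zero => simp
  | tmul a b => simp
  | add x y hx hy => simp only [TensorProduct.add_tmul, map_add, hx, hy]

theorem shear_comp_shear_of_convolution (c : H →ₗ[k] H ⊗[k] H) (ε : H →ₗ[k] k)
    (A B : H →ₗ[k] Module.End k W)
    (hc : ∀ h, TensorProduct.assoc k H H H (c.rTensor H (c h)) = c.lTensor H (c h))
    (hε : ∀ h, ε.lTensor H (c h) = h ⊗ₜ 1)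
    (hAB : ∀ h w, TensorProduct.lift (A.compl₂ (B.flip w)) (c h) = ε h • w) :
    shear c A ∘ₗ shear c B = LinearMap.id := by
  refine TensorProduct.ext' fun h w ↦ ?_
  have h₁ (x : H ⊗[k] H) : shear c A ((B.flip w).lTensor H x) =
      (TensorProduct.lift (A.compl₂ (B.flip w))).lTensor H
        (TensorProduct.assoc k H H H (c.rTensor H x)) := by
    induction x with
    | zero => simp
    | add x y hx hy => simp only [map_add, hx, hy]
    | tmul a b =>
      simp only [LinearMap.lTensor_tmul, LinearMap.rTensor_tmul, shear_tmul]
      generalize c a = y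
      induction y with
      | zero => simp
      | add x y hx hy => simp only [TensorProduct.add_tmul, map_add, hx, hy]
      | tmul a b => simp
  have h₂ (x : H ⊗[k] H) : (TensorProduct.lift (A.compl₂ (B.flip w))).lTensor H (c.lTensor H x) =
      (LinearMap.toSpanSingleton k W w).lTensor H (ε.lTensor H x) := by
    induction x with
    | zero => simp
    | add x y hx hy => simp only [map_add, hx, hy]
    | tmul a b => simp [hAB]
  rw [LinearMap.comp_apply, shear_tmul, h₁, hc, h₂, hε]
  simp

end Shear

section Diagonal

open CategoryTheory

attribute [local instance] ModuleCat.moduleOfAlgebraModule ModuleCat.isScalarTower_of_algebra_moduleCat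

variable {k : Type u} [Field k] {H : Type u} [Ring H] [HopfAlgebra k H]
  {M N X M' N' V : Type u} [AddCommGroup M] [Module k M] [Module H M] [IsScalarTower k H M]
  [AddCommGroup N] [Module k N] [Module H N] [IsScalarTower k H N]
  [AddCommGroup X] [Module k X] [Module H X] [IsScalarTower k H X]
  [AddCommGroup M'] [Module k M'] [Module H M'] [IsScalarTower k H M']
  [AddCommGroup N'] [Module k N'] [Module H N'] [IsScalarTower k H N']
  [AddCommGroup V] [Module k V]

theorem tensorRep_tmul (h : H) (m : M) (n : N) : tensorRep k H M N h (m ⊗ₜ n) =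
    TensorProduct.map ((hRep k H M).toLinearMap.flip m) ((hRep k H N).toLinearMap.flip n)
      (Coalgebra.comul h) := by
  simp only [tensorRep, AlgHom.comp_apply, Bialgebra.comulAlgHom_apply]
  generalize Coalgebra.comul (R := k) h = x
  induction x with
  | zero => simp
  | add x y hx hy => simp only [map_add, LinearMap.add_apply, hx, hy]
  | tmul a b => simp [hRep, Module.endTensorEndAlgHom_apply]

variable (k H M N) in
/-- The underlying vector space of the diagonal tensor product. -/
def tensorModEquiv : M ⊗[k] N ≃ₗ[k] tensorMod k H M N where
  __ := AddEquiv.refl (M ⊗[k] N)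
  map_smul' c t := by
    change c • t = tensorRep k H M N (algebraMap k H c) t
    rw [AlgHom.commutes]
    rfl

theorem smul_tensorModEquiv (h : H) (t : M ⊗[k] N) :
    h • tensorModEquiv k H M N t = tensorModEquiv k H M N (tensorRep k H M N h t) := rfl

/-- A `k`-linear map commuting with the actions of `H` is `H`-linear. -/
def linearMapOfSMul (f : M →ₗ[k] N) (h : ∀ (a : H) m, f (a • m) = a • f m) : M →ₗ[H] N where
  __ := f
  map_smul' := h

theorem tensorRep_map (f : M →ₗ[H] M') (g : N →ₗ[H] N') (h : H) (t : M ⊗[k] N) :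
    TensorProduct.map (f.restrictScalars k) (g.restrictScalars k) (tensorRep k H M N h t) =
      tensorRep k H M' N' h
        (TensorProduct.map (f.restrictScalars k) (g.restrictScalars k) t) := by
  induction t with
  | zero => simp
  | add x y hx hy => simp only [map_add, hx, hy]
  | tmul m n =>
    rw [TensorProduct.map_tmul, tensorRep_tmul, tensorRep_tmul]
    generalize Coalgebra.comul (R := k) h = x
    induction x with
    | zero => simp
    | add x y hx hy => simp only [map_add, hx, hy]
    | tmul a b => simp [hRep]

variable (k) in
/-- The diagonal tensor product of two `H`-linear maps. -/
def tensorModMap (f : M →ₗ[H] M') (g : N →ₗ[H] N') :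
    tensorMod k H M N →ₗ[H] tensorMod k H M' N' :=
  linearMapOfSMul (k := k) (tensorModEquiv k H M' N' ∘ₗ
    TensorProduct.map (f.restrictScalars k) (g.restrictScalars k) ∘ₗ
    (tensorModEquiv k H M N).symm) fun _ t ↦
      congrArg (tensorModEquiv k H M' N') (tensorRep_map f g _ t)

theorem tensorModMap_apply (f : M →ₗ[H] M') (g : N →ₗ[H] N') (t : M ⊗[k] N) :
    tensorModMap k f g (tensorModEquiv k H M N t) = tensorModEquiv k H M' N'
      (TensorProduct.map (f.restrictScalars k) (g.restrictScalars k) t) := rfl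

theorem tensorModMap_comp {M'' N'' : Type u} [AddCommGroup M''] [Module k M''] [Module H M'']
    [IsScalarTower k H M''] [AddCommGroup N''] [Module k N''] [Module H N'']
    [IsScalarTower k H N''] (f' : M' →ₗ[H] M'') (g' : N' →ₗ[H] N'') (f : M →ₗ[H] M')
    (g : N →ₗ[H] N') :
    tensorModMap k (f' ∘ₗ f) (g' ∘ₗ g) = tensorModMap k f' g' ∘ₗ tensorModMap k f g := by
  refine LinearMap.ext fun t ↦ ?_
  obtain ⟨t, rfl⟩ := (tensorModEquiv k H M N).surjective t
  rw [LinearMap.comp_apply, tensorModMap_apply, tensorModMap_apply, tensorModMap_apply]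
  exact congrArg _ (LinearMap.congr_fun (TensorProduct.map_comp (f'.restrictScalars k)
    (g'.restrictScalars k) (f.restrictScalars k) (g.restrictScalars k)) t)

theorem tensorModMap_id : tensorModMap k (LinearMap.id : M →ₗ[H] M) (LinearMap.id : N →ₗ[H] N) =
    LinearMap.id := by
  refine LinearMap.ext fun t ↦ ?_
  obtain ⟨t, rfl⟩ := (tensorModEquiv k H M N).surjective t
  rw [tensorModMap_apply]
  exact congrArg _ (LinearMap.congr_fun (TensorProduct.map_id (R := k) (M := M) (N := N)) t)

theorem IsShortExact.tensorMod_left {f : M →ₗ[H] N} {g : N →ₗ[H] X} (h : IsShortExact f g) :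
    IsShortExact (tensorModMap k (LinearMap.id : M' →ₗ[H] M') f)
      (tensorModMap k (LinearMap.id : M' →ₗ[H] M') g) :=
  ⟨Module.Flat.lTensor_preserves_injective_linearMap (M := M') (f.restrictScalars k) h.inj,
    lTensor_exact M' (f := f.restrictScalars k) (g := g.restrictScalars k) h.exact h.surj,
    LinearMap.lTensor_surjective M' (g := g.restrictScalars k) h.surj⟩

theorem IsShortExact.tensorMod_right {f : M →ₗ[H] N} {g : N →ₗ[H] X} (h : IsShortExact f g) :
    IsShortExact (tensorModMap k f (LinearMap.id : M' →ₗ[H] M'))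
      (tensorModMap k g (LinearMap.id : M' →ₗ[H] M')) :=
  ⟨Module.Flat.rTensor_preserves_injective_linearMap (M := M') (f.restrictScalars k) h.inj,
    rTensor_exact M' (f := f.restrictScalars k) (g := g.restrictScalars k) h.exact h.surj,
    LinearMap.rTensor_surjective M' (g := g.restrictScalars k) h.surj⟩

end Diagonal

section DiagonalProjective

variable {k : Type u} [Field k] {H : Type u} [Ring H] [HopfAlgebra k H]
  {W : Type u} [AddCommGroup W] [Module k W] [Module H W] [IsScalarTower k H W]

theorem lift_hRep_compl₂_left (T : H →ₗ[k] H) (w : W) (x : H ⊗[k] H) :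
    TensorProduct.lift ((hRep k H W).toLinearMap.compl₂
      (((hRep k H W).toLinearMap ∘ₗ T).flip w)) x = LinearMap.mul' k H (T.lTensor H x) • w := by
  induction x with
  | zero => simp
  | add x y hx hy => simp only [map_add, hx, hy, add_smul]
  | tmul a b => simp [hRep, mul_smul]

theorem lift_hRep_compl₂_right (T : H →ₗ[k] H) (w : W) (x : H ⊗[k] H) :
    TensorProduct.lift (((hRep k H W).toLinearMap ∘ₗ T).compl₂
      ((hRep k H W).toLinearMap.flip w)) x = LinearMap.mul' k H (T.rTensor H x) • w := by
  induction x with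
  | zero => simp
  | add x y hx hy => simp only [map_add, hx, hy, add_smul]
  | tmul a b => simp [hRep, mul_smul]

theorem bijective_shear (c : H →ₗ[k] H ⊗[k] H) (T : H →ₗ[k] H)
    (hc : ∀ h, TensorProduct.assoc k H H H (c.rTensor H (c h)) = c.lTensor H (c h))
    (hε : ∀ h, (Coalgebra.counit (R := k)).lTensor H (c h) = h ⊗ₜ 1)
    (hl : ∀ h, LinearMap.mul' k H (T.lTensor H (c h)) = algebraMap k H (Coalgebra.counit h))
    (hr : ∀ h, LinearMap.mul' k H (T.rTensor H (c h)) = algebraMap k H (Coalgebra.counit h)) :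
    Function.Bijective (shear c (hRep k H W).toLinearMap) := by
  have h₁ := shear_comp_shear_of_convolution c Coalgebra.counit (hRep k H W).toLinearMap
    ((hRep k H W).toLinearMap ∘ₗ T) hc hε fun h w ↦ by
      rw [lift_hRep_compl₂_left, hl, algebraMap_smul]
  have h₂ := shear_comp_shear_of_convolution c Coalgebra.counit
    ((hRep k H W).toLinearMap ∘ₗ T) (hRep k H W).toLinearMap hc hε fun h w ↦ by
      rw [lift_hRep_compl₂_right, hr, algebraMap_smul]
  exact Function.bijective_iff_has_inverse.2 ⟨_, fun x ↦ LinearMap.congr_fun h₂ x,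
    fun x ↦ LinearMap.congr_fun h₁ x⟩

theorem bijective_shear_comul :
    Function.Bijective (shear Coalgebra.comul (hRep k H W).toLinearMap) :=
  bijective_shear _ (HopfAlgebra.antipode k) Coalgebra.coassoc_apply
    Coalgebra.lTensor_counit_comul HopfAlgebra.mul_antipode_lTensor_comul_apply
    HopfAlgebra.mul_antipode_rTensor_comul_apply

variable (k H) in
/-- The opposite comultiplication. -/
def comulCop : H →ₗ[k] H ⊗[k] H :=
  (TensorProduct.comm k H H).toLinearMap ∘ₗ Coalgebra.comul

theorem comulCop_coassoc (h : H) :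
    TensorProduct.assoc k H H H ((comulCop k H).rTensor H (comulCop k H h)) =
      (comulCop k H).lTensor H (comulCop k H h) := by
  let σ : H ⊗[k] (H ⊗[k] H) →ₗ[k] H ⊗[k] (H ⊗[k] H) :=
    (TensorProduct.assoc k H H H).toLinearMap ∘ₗ
      (TensorProduct.comm k H H).toLinearMap.rTensor H ∘ₗ
      (TensorProduct.comm k H (H ⊗[k] H)).toLinearMap
  have h₁ (x : H ⊗[k] H) : TensorProduct.assoc k H H H ((comulCop k H).rTensor H
      (TensorProduct.comm k H H x)) = σ (Coalgebra.comul.lTensor H x) := by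
    induction x with
    | zero => simp
    | add x y hx hy => simp only [map_add, hx, hy]
    | tmul a b => simp [σ, comulCop]
  have h₂ (x : H ⊗[k] H) : (comulCop k H).lTensor H (TensorProduct.comm k H H x) =
      σ (TensorProduct.assoc k H H H (Coalgebra.comul.rTensor H x)) := by
    induction x with
    | zero => simp
    | add x y hx hy => simp only [map_add, hx, hy]
    | tmul a b =>
      simp only [LinearMap.rTensor_tmul, TensorProduct.comm_tmul, LinearMap.lTensor_tmul,
        comulCop, LinearMap.comp_apply]
      generalize Coalgebra.comul (R := k) a = y
      induction y with
      | zero => simp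
      | add x y hx hy => simp only [TensorProduct.add_tmul, TensorProduct.tmul_add, map_add, hx, hy]
      | tmul a b => simp [σ]
  exact (h₁ _).trans ((congrArg σ (Coalgebra.coassoc_apply h).symm).trans (h₂ _).symm)

theorem bijective_shear_comulCop
    (hS : Function.Bijective (HopfAlgebra.antipode (R := k) (A := H))) :
    Function.Bijective (shear (comulCop k H) (hRep k H W).toLinearMap) := by
  let e := LinearEquiv.ofBijective _ hS
  have he (x) : HopfAlgebra.antipode k (e.symm x) = x := e.apply_symm_apply x
  have hε (r : k) : HopfAlgebra.antipode k (algebraMap k H r) = algebraMap k H r := by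
    rw [Algebra.algebraMap_eq_smul_one, map_smul, HopfAlgebra.antipode_one]
  refine bijective_shear _ e.symm.toLinearMap comulCop_coassoc (fun h ↦ ?_) (fun h ↦ ?_) fun h ↦ ?_
  · have (x : H ⊗[k] H) : (Coalgebra.counit (R := k)).lTensor H (TensorProduct.comm k H H x) =
        TensorProduct.comm k k H ((Coalgebra.counit (R := k)).rTensor H x) := by
      induction x with
      | zero => simp
      | add x y hx hy => simp only [map_add, hx, hy]
      | tmul a b => simp
    simp [comulCop, this]
  · have (x : H ⊗[k] H) : HopfAlgebra.antipode k (LinearMap.mul' k H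
        (e.symm.toLinearMap.lTensor H (TensorProduct.comm k H H x))) =
        LinearMap.mul' k H ((HopfAlgebra.antipode k).lTensor H x) := by
      induction x with
      | zero => simp
      | add x y hx hy => simp only [map_add, hx, hy]
      | tmul a b => simp [HopfAlgebra.antipode_mul_antidistrib, he]
    apply hS.1
    rw [hε]
    exact (this _).trans (HopfAlgebra.mul_antipode_lTensor_comul_apply h)
  · have (x : H ⊗[k] H) : HopfAlgebra.antipode k (LinearMap.mul' k H
        (e.symm.toLinearMap.rTensor H (TensorProduct.comm k H H x))) =
        LinearMap.mul' k H ((HopfAlgebra.antipode k).rTensor H x) := by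
      induction x with
      | zero => simp
      | add x y hx hy => simp only [map_add, hx, hy]
      | tmul a b => simp [HopfAlgebra.antipode_mul_antidistrib, he]
    apply hS.1
    rw [hε]
    exact (this _).trans (HopfAlgebra.mul_antipode_rTensor_comul_apply h)

open CategoryTheory

attribute [local instance] ModuleCat.moduleOfAlgebraModule ModuleCat.isScalarTower_of_algebra_moduleCat

variable {X V Y P : Type u} [AddCommGroup X] [Module k X] [Module H X] [IsScalarTower k H X]
  [AddCommGroup V] [Module k V] [AddCommGroup Y] [Module k Y] [Module H Y] [IsScalarTower k H Y]
  [AddCommGroup P] [Module k P] [Module H P] [IsScalarTower k H P]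

/-- The `H`-linear extension `h ⊗ v ↦ h • f v` of a `k`-linear map `f`. -/
def smulLift (f : V →ₗ[k] Y) : H ⊗[k] V →ₗ[H] Y :=
  TensorProduct.AlgebraTensorModule.lift (LinearMap.toSpanSingleton H (V →ₗ[k] Y) f)

@[simp]
theorem smulLift_tmul (f : V →ₗ[k] Y) (h : H) (v : V) : smulLift f (h ⊗ₜ[k] v) = h • f v := rfl

theorem projective_of_bijective_smulLift (f : V →ₗ[k] Y)
    (hf : Function.Bijective (smulLift (H := H) f)) : Module.Projective H Y :=
  .of_equiv (LinearEquiv.ofBijective _ hf)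

theorem projective_tensorMod_right_of_free :
    Module.Projective H (tensorMod k H (H ⊗[k] V) X) := by
  let r : H ⊗[k] (X ⊗[k] V) ≃ₗ[k] (H ⊗[k] V) ⊗[k] X :=
    (TensorProduct.comm k X V).lTensor H ≪≫ₗ (TensorProduct.assoc k H V X).symm
  refine projective_of_bijective_smulLift (k := k)
    ((tensorModEquiv k H (H ⊗[k] V) X).toLinearMap ∘ₗ r.toLinearMap ∘ₗ TensorProduct.mk k H _ 1) ?_
  have key : (smulLift (H := H) ((tensorModEquiv k H (H ⊗[k] V) X).toLinearMap ∘ₗ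
      r.toLinearMap ∘ₗ TensorProduct.mk k H _ 1)).restrictScalars k =
      ((tensorModEquiv k H (H ⊗[k] V) X).toLinearMap ∘ₗ r.toLinearMap) ∘ₗ
        shear Coalgebra.comul (hRep k H (X ⊗[k] V)).toLinearMap := by
    ext h x v
    simp only [TensorProduct.AlgebraTensorModule.curry_apply, TensorProduct.curry_apply,
      LinearMap.restrictScalars_apply, smulLift_tmul, LinearMap.comp_apply, LinearEquiv.coe_coe,
      smul_tensorModEquiv, shear_tmul]
    refine congrArg _ ?_
    change tensorRep k H (H ⊗[k] V) X h ((1 ⊗ₜ v) ⊗ₜ x) = _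
    rw [tensorRep_tmul]
    generalize Coalgebra.comul (R := k) h = y
    induction y with
    | zero => simp
    | add x y hx hy => simp only [map_add, hx, hy]
    | tmul a b => simp [r, hRep, TensorProduct.smul_tmul']
  have : Function.Bijective ((smulLift (H := H) ((tensorModEquiv k H (H ⊗[k] V)
      X).toLinearMap ∘ₗ r.toLinearMap ∘ₗ TensorProduct.mk k H _ 1)).restrictScalars k) := by
    rw [key]
    exact ((tensorModEquiv k H (H ⊗[k] V) X).bijective.comp r.bijective).comp
      bijective_shear_comul
  exact this

theorem projective_tensorMod_left_of_free
    (hS : Function.Bijective (HopfAlgebra.antipode (R := k) (A := H))) :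
    Module.Projective H (tensorMod k H X (H ⊗[k] V)) := by
  let r : H ⊗[k] (X ⊗[k] V) ≃ₗ[k] X ⊗[k] (H ⊗[k] V) := TensorProduct.leftComm k H X V
  refine projective_of_bijective_smulLift (k := k)
    ((tensorModEquiv k H X (H ⊗[k] V)).toLinearMap ∘ₗ r.toLinearMap ∘ₗ TensorProduct.mk k H _ 1) ?_
  have key : (smulLift (H := H) ((tensorModEquiv k H X (H ⊗[k] V)).toLinearMap ∘ₗ
      r.toLinearMap ∘ₗ TensorProduct.mk k H _ 1)).restrictScalars k =
      ((tensorModEquiv k H X (H ⊗[k] V)).toLinearMap ∘ₗ r.toLinearMap) ∘ₗ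
        shear (comulCop k H) (hRep k H (X ⊗[k] V)).toLinearMap := by
    ext h x v
    simp only [TensorProduct.AlgebraTensorModule.curry_apply, TensorProduct.curry_apply,
      LinearMap.restrictScalars_apply, smulLift_tmul, LinearMap.comp_apply, LinearEquiv.coe_coe,
      smul_tensorModEquiv, shear_tmul, comulCop]
    refine congrArg _ ?_
    change tensorRep k H X (H ⊗[k] V) h (x ⊗ₜ (1 ⊗ₜ v)) = _
    rw [tensorRep_tmul]
    generalize Coalgebra.comul (R := k) h = y
    induction y with
    | zero => simp
    | add x y hx hy => simp only [map_add, hx, hy]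
    | tmul a b => simp [r, hRep, TensorProduct.smul_tmul']
  have : Function.Bijective ((smulLift (H := H) ((tensorModEquiv k H X
      (H ⊗[k] V)).toLinearMap ∘ₗ r.toLinearMap ∘ₗ TensorProduct.mk k H _ 1)).restrictScalars k) := by
    rw [key]
    exact ((tensorModEquiv k H X (H ⊗[k] V)).bijective.comp r.bijective).comp
      (bijective_shear_comulCop hS)
  exact this

variable (k P) in
/-- A projective module is a retract of the free module on its underlying vector space. -/
theorem exists_retraction_of_projective [Module.Projective H P] :
    ∃ (s : P →ₗ[H] H ⊗[k] P) (p : H ⊗[k] P →ₗ[H] P), p ∘ₗ s = LinearMap.id :=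
  let p : H ⊗[k] P →ₗ[H] P := smulLift LinearMap.id
  let ⟨s, hs⟩ := Module.projective_lifting_property p LinearMap.id fun x ↦
    ⟨1 ⊗ₜ x, by simp [p]⟩
  ⟨s, p, hs⟩

variable (k P X) in
theorem projective_tensorMod_right [Module.Projective H P] :
    Module.Projective H (tensorMod k H P X) := by
  obtain ⟨s, p, h⟩ := exists_retraction_of_projective (k := k) (H := H) P
  have := projective_tensorMod_right_of_free (k := k) (H := H) (V := P) (X := X)
  refine .of_split (tensorModMap k s LinearMap.id) (tensorModMap k p LinearMap.id) ?_
  rw [← tensorModMap_comp, h, LinearMap.id_comp, tensorModMap_id]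

variable (k P X) in
theorem projective_tensorMod_left [Module.Projective H P]
    (hS : Function.Bijective (HopfAlgebra.antipode (R := k) (A := H))) :
    Module.Projective H (tensorMod k H X P) := by
  obtain ⟨s, p, h⟩ := exists_retraction_of_projective (k := k) (H := H) P
  have := projective_tensorMod_left_of_free (k := k) (H := H) (V := P) (X := X) hS
  refine .of_split (tensorModMap k LinearMap.id s) (tensorModMap k LinearMap.id p) ?_
  rw [← tensorModMap_comp, h, LinearMap.id_comp, tensorModMap_id]

end DiagonalProjective

section Syzygies

open CategoryTheory

attribute [local instance] ModuleCat.moduleOfAlgebraModule ModuleCat.isScalarTower_of_algebra_moduleCat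

variable (k : Type u) [Field k] (H : Type u) [Ring H] [HopfAlgebra k H]

/-- The augmentation ideal of `H`. -/
def augmentationIdeal : Ideal H :=
  RingHom.ker (Bialgebra.counitAlgHom k H)

variable {H}

theorem lift_counit_smul_comul {M : Type u} [AddCommGroup M] [Module k M] [Module H M]
    [IsScalarTower k H M] (h : H) (m : M) :
    TensorProduct.lid k M (TensorProduct.map Coalgebra.counit ((hRep k H M).toLinearMap.flip m)
      (Coalgebra.comul h)) = h • m := by
  have (x : H ⊗[k] H) : TensorProduct.map Coalgebra.counit ((hRep k H M).toLinearMap.flip m) x =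
      ((hRep k H M).toLinearMap.flip m).lTensor k (Coalgebra.counit.rTensor H x) := by
    rw [← LinearMap.comp_apply, LinearMap.lTensor_comp_rTensor]
  rw [this, Coalgebra.rTensor_counit_comul]
  simp [hRep]

/-- Every module `M` is the quotient of `H ⊗ M` by `H⁺ ⊗ M`. -/
theorem exists_isShortExact_augmentation (M : ModuleCat.{u} H) :
    ∃ (i : tensorMod k H (augmentationIdeal k H) M →ₗ[H] tensorMod k H H M)
      (p : tensorMod k H H M →ₗ[H] M), IsShortExact i p := by
  let ε : H →ₗ[k] k := Coalgebra.counit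
  let I : augmentationIdeal k H →ₗ[H] H := (augmentationIdeal k H).subtype
  let p : tensorMod k H H M →ₗ[H] M := linearMapOfSMul (k := k)
    ((TensorProduct.lid k M).toLinearMap ∘ₗ ε.rTensor M ∘ₗ (tensorModEquiv k H H M).symm) (by
      intro h t
      obtain ⟨t, rfl⟩ := (tensorModEquiv k H H M).surjective t
      rw [smul_tensorModEquiv]
      simp only [LinearMap.comp_apply, LinearEquiv.coe_coe, LinearEquiv.symm_apply_apply]
      induction t with
      | zero => simp
      | add x y hx hy => simp only [map_add, smul_add, hx, hy]
      | tmul a m =>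
        have (x : H ⊗[k] H) : ε.rTensor M (TensorProduct.map
            ((hRep k H H).toLinearMap.flip a) ((hRep k H M).toLinearMap.flip m) x) =
            ε a • TensorProduct.map ε ((hRep k H M).toLinearMap.flip m) x := by
          induction x with
          | zero => simp
          | add x y hx hy => simp only [map_add, smul_add, hx, hy]
          | tmul b c => simp [hRep, ε, TensorProduct.smul_tmul', mul_comm]
        rw [tensorRep_tmul, this, map_smul, lift_counit_smul_comul]
        exact smul_comm (ε a) h m)
  refine ⟨tensorModMap k I LinearMap.id, p,
    Module.Flat.rTensor_preserves_injective_linearMap (M := M) (I.restrictScalars k)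
      Subtype.val_injective, fun t ↦ ?_, ?_⟩
  · obtain ⟨t, rfl⟩ := (tensorModEquiv k H H M).surjective t
    refine Iff.trans (?_ : _ ↔ ε.rTensor M t = 0)
      (rTensor_exact M (f := I.restrictScalars k) (g := ε) (fun x ↦ ?_) ?_ t)
    · exact LinearEquiv.map_eq_zero_iff (TensorProduct.lid k M)
    · exact ⟨fun h ↦ ⟨⟨x, h⟩, rfl⟩, by rintro ⟨y, rfl⟩; exact y.2⟩
    · exact fun r ↦ ⟨algebraMap k H r, by simp [ε]⟩
  · intro m
    exact ⟨tensorModEquiv k H H M (1 ⊗ₜ m), by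
      change TensorProduct.lid k M (ε.rTensor M (1 ⊗ₜ m)) = m
      simp [ε]⟩

/-- The iterated syzygy `H⁺ ⊗ ⋯ ⊗ H⁺ ⊗ M`. -/
def syzygy : ℕ → ModuleCat.{u} H → ModuleCat.{u} H
  | 0, M => M
  | n + 1, M => syzygy n (tensorMod k H (augmentationIdeal k H) M)

variable {k}

theorem IsShortExact.exists_syzygy (n : ℕ) {A B C : ModuleCat.{u} H} {f : A →ₗ[H] B}
    {g : B →ₗ[H] C} (h : IsShortExact f g) :
    ∃ (f' : syzygy k n A →ₗ[H] syzygy k n B) (g' : syzygy k n B →ₗ[H] syzygy k n C),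
      IsShortExact f' g' := by
  induction n generalizing A B C with
  | zero => exact ⟨f, g, h⟩
  | succ n ih => exact ih h.tensorMod_left

theorem projective_syzygy (hS : Function.Bijective (HopfAlgebra.antipode (R := k) (A := H)))
    (n : ℕ) (M : ModuleCat.{u} H) [Module.Projective H M] :
    Module.Projective H (syzygy k n M) := by
  induction n generalizing M with
  | zero => assumption
  | succ n ih =>
    have := projective_tensorMod_left k (augmentationIdeal k H) M hS
    exact ih _

theorem hasProjectiveDimensionLT_of_projective (M : ModuleCat.{u} H) [h : Module.Projective H M]
    (n : ℕ) : HasProjectiveDimensionLT M (n + 1) :=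
  have := (hasProjectiveDimensionLT_one_iff M).2 h
  hasProjectiveDimensionLT_of_ge M 1 _ (by omega)

theorem projective_syzygy_of_hasProjectiveDimensionLT (n : ℕ) (M : ModuleCat.{u} H)
    (h : HasProjectiveDimensionLT M (n + 1)) : Module.Projective H (syzygy k n M) := by
  induction n generalizing M with
  | zero => exact (hasProjectiveDimensionLT_one_iff M).1 h
  | succ n ih =>
    obtain ⟨i, p, hip⟩ := exists_isShortExact_augmentation k M
    have := projective_tensorMod_right k M H (H := H)
    exact ih _ (hip.hasProjectiveDimensionLT_X₁ _ (hasProjectiveDimensionLT_of_projective _ n) h)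

theorem projective_tensorMod_syzygy (n : ℕ) (M Λ : ModuleCat.{u} H)
    (h : HasProjectiveDimensionLT (tensorMod k H M Λ) (n + 1)) :
    Module.Projective H (tensorMod k H (syzygy k n M) Λ) := by
  induction n generalizing M with
  | zero => exact (hasProjectiveDimensionLT_one_iff _).1 h
  | succ n ih =>
    obtain ⟨i, p, hip⟩ := exists_isShortExact_augmentation k M
    have := projective_tensorMod_right k M H (H := H)
    have := projective_tensorMod_right k Λ (tensorMod k H H M) (H := H)
    exact ih _ ((hip.tensorMod_right (k := k) (M' := Λ)).hasProjectiveDimensionLT_X₁ _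
      (hasProjectiveDimensionLT_of_projective _ n) h)

theorem hasProjectiveDimensionLT_tensorMod
    (hS : Function.Bijective (HopfAlgebra.antipode (R := k) (A := H)))
    (n : ℕ) (X Λ : ModuleCat.{u} H) (h : HasProjectiveDimensionLT Λ (n + 1)) :
    HasProjectiveDimensionLT (tensorMod k H X Λ) (n + 1) := by
  induction n generalizing Λ with
  | zero =>
    have := (hasProjectiveDimensionLT_one_iff _).1 h
    exact (hasProjectiveDimensionLT_one_iff _).2 (projective_tensorMod_left k X Λ hS)
  | succ n ih =>
    obtain ⟨K, P, i, p, hP, hip⟩ := exists_isShortExact_of_projective Λ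
    have := projective_tensorMod_left k X P hS
    exact (hip.tensorMod_left (k := k) (M' := X)).hasProjectiveDimensionLT_X₃ _
      (ih K (hip.hasProjectiveDimensionLT_X₁ _ (hasProjectiveDimensionLT_of_projective _ n) h))
      (hasProjectiveDimensionLT_of_projective _ (n + 1))

/-- An invariant vector `v` of `Λ` gives natural embeddings `X → X ⊗ Λ`, with cokernel `X ⊗ L`
for a fixed `L`. -/
theorem exists_isShortExact_of_invariant (Λ : ModuleCat.{u} H) (v : Λ) (hv : v ≠ 0)
    (hε : ∀ h : H, h • v = (Coalgebra.counit h : k) • v) :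
    ∃ (L : ModuleCat.{u} H) (π : ∀ X : ModuleCat.{u} H, tensorMod k H X Λ →ₗ[H] tensorMod k H X L)
      (ι : ∀ X : ModuleCat.{u} H, X →ₗ[H] tensorMod k H X Λ), ∀ X, IsShortExact (ι X) (π X) ∧
        ∀ x, ι X x = tensorModEquiv k H X Λ (x ⊗ₜ v) := by
  let N : Submodule H Λ := Submodule.span H {v}
  let L : ModuleCat.{u} H := ModuleCat.of H (Λ ⧸ N)
  let q : Λ →ₗ[H] L := N.mkQ
  let s : k →ₗ[k] Λ := LinearMap.toSpanSingleton k Λ v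
  have hs {X : ModuleCat.{u} H} (x : X) :
      x ⊗ₜ[k] v = s.lTensor X ((TensorProduct.rid k X).symm x) := by
    rw [TensorProduct.rid_symm_apply, LinearMap.lTensor_tmul, LinearMap.toSpanSingleton_apply,
      one_smul]
  refine ⟨L, fun X ↦ tensorModMap k LinearMap.id q, fun X ↦ linearMapOfSMul (k := k)
    ((tensorModEquiv k H X Λ).toLinearMap ∘ₗ (TensorProduct.mk k X Λ).flip v) fun h x ↦ ?_,
    fun X ↦ ⟨⟨?_, fun t ↦ ?_, ?_⟩, fun x ↦ rfl⟩⟩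
  · have key (y : H ⊗[k] H) : TensorProduct.map ((hRep k H X).toLinearMap.flip x)
        ((hRep k H Λ).toLinearMap.flip v) y =
        (TensorProduct.mk k X Λ).flip v (((hRep k H X).toLinearMap.flip x)
          (TensorProduct.rid k H (Coalgebra.counit.lTensor H y))) := by
      induction y with
      | zero => simp
      | add x y hx hy => simp only [map_add, hx, hy]
      | tmul a b => simp [hRep, hε, TensorProduct.smul_tmul']
    rw [LinearMap.comp_apply, LinearMap.comp_apply, LinearEquiv.coe_coe, smul_tensorModEquiv]
    refine congrArg _ ?_
    change _ = tensorRep k H X Λ h (x ⊗ₜ v)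
    rw [tensorRep_tmul, key, Coalgebra.lTensor_counit_comul]
    simp [hRep]
  · intro x y hxy
    replace hxy : x ⊗ₜ[k] v = y ⊗ₜ[k] v := hxy
    rw [hs, hs] at hxy
    exact (TensorProduct.rid k X).symm.injective
      (Module.Flat.lTensor_preserves_injective_linearMap s (smul_left_injective k hv) hxy)
  · obtain ⟨t, rfl⟩ := (tensorModEquiv k H X Λ).surjective t
    refine (lTensor_exact X (f := s) (g := q.restrictScalars k) (fun y ↦ ?_)
      N.mkQ_surjective t).trans ?_
    · change N.mkQ y = 0 ↔ _
      rw [Submodule.mkQ_apply, Submodule.Quotient.mk_eq_zero, Submodule.mem_span_singleton]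
      constructor
      · rintro ⟨h, rfl⟩
        exact ⟨Coalgebra.counit h, (hε h).symm⟩
      · rintro ⟨r, rfl⟩
        exact ⟨algebraMap k H r, by simp [s]⟩
    · constructor
      · rintro ⟨z, rfl⟩
        refine ⟨TensorProduct.rid k X z, ?_⟩
        change TensorProduct.rid k X z ⊗ₜ[k] v = _
        rw [hs, LinearEquiv.symm_apply_apply]
        rfl
      · rintro ⟨x, hx⟩
        exact ⟨_, (hs x).symm.trans hx⟩
  · exact LinearMap.lTensor_surjective X (g := q.restrictScalars k) N.mkQ_surjective

/-- If `H` has a nonzero invariant vector in a module of projective dimension at most `n`, then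
all modules have Gorenstein projective dimension at most `n`. -/
theorem gProjDimLE_of_invariant
    (hS : Function.Bijective (HopfAlgebra.antipode (R := k) (A := H))) (n : ℕ)
    (Λ : ModuleCat.{u} H) (v : Λ) (hv : v ≠ 0)
    (hε : ∀ h : H, h • v = (Coalgebra.counit h : k) • v)
    (hΛ : HasProjectiveDimensionLT Λ (n + 1)) (M : ModuleCat.{u} H) : GProjDimLE H n M := by
  obtain ⟨L, π, ι, hι⟩ := exists_isShortExact_of_invariant Λ v hv hε
  have hpd (X : ModuleCat.{u} H) := hasProjectiveDimensionLT_tensorMod hS n X Λ hΛ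
  have hExt (Z : ModuleCat.{u} H) (hZ : Module.Projective H (tensorMod k H Z Λ)) :
      ExtVanishes Z := by
    intro A B Q i p hip hQ t
    obtain ⟨ρ, hρ⟩ := (hip.tensorMod_right (k := k) (M' := Λ)).exists_retraction
    have := projective_tensorMod_right k L Q (H := H)
    obtain ⟨r, hr⟩ := (hι Q).1.exists_retraction
    refine ⟨r ∘ₗ tensorModMap k t LinearMap.id ∘ₗ ρ ∘ₗ ι B, LinearMap.ext fun a ↦ ?_⟩
    have h₁ : ι B (i a) = tensorModMap k i LinearMap.id (ι A a) := by
      rw [(hι B).2, (hι A).2]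
      rfl
    have h₂ : tensorModMap k t LinearMap.id (ι A a) = ι Q (t a) := by
      rw [(hι Q).2, (hι A).2]
      rfl
    have h₃ := LinearMap.congr_fun hρ (ι A a)
    have h₄ := LinearMap.congr_fun hr (t a)
    simp only [LinearMap.comp_apply, LinearMap.id_apply] at h₃ h₄ ⊢
    rw [h₁, h₃, h₂, h₄]
  have hGP (M : ModuleCat.{u} H) : IsGorensteinProjective H (syzygy k n M) := by
    refine isGorensteinProjective_of_class (fun N ↦ ∃ M, N = syzygy k n M) ?_ _ ⟨M, rfl⟩
    rintro _ ⟨M, rfl⟩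
    refine ⟨hExt _ (projective_tensorMod_syzygy n M Λ (hpd M)), ?_, ?_⟩
    · obtain ⟨f, g, hfg⟩ := (hι M).1.exists_syzygy (k := k) n
      exact ⟨_, _, f, g, projective_syzygy_of_hasProjectiveDimensionLT n _ (hpd M), hfg, _, rfl⟩
    · obtain ⟨i, p, hip⟩ := exists_isShortExact_augmentation k M
      obtain ⟨f, g, hfg⟩ := hip.exists_syzygy (k := k) n
      have := projective_tensorMod_right k M H (H := H)
      exact ⟨_, _, f, g, projective_syzygy hS n _, hfg, _, rfl⟩
  have key (n : ℕ) (M : ModuleCat.{u} H) (h : IsGorensteinProjective H (syzygy k n M)) :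
      GProjDimLE H n M := by
    induction n generalizing M with
    | zero => exact h
    | succ n ih =>
      obtain ⟨i, p, hip⟩ := exists_isShortExact_augmentation k M
      obtain ⟨e⟩ := hip.nonempty_equiv_ker
      exact .inr ⟨tensorMod k H H M, p, .of_projective _ (projective_tensorMod_right k M H), hip.surj,
        (ih _ h).of_equiv e⟩
  exact key n M (hGP M)

/-- The Gorenstein projective dimension of the trivial module bounds that of all modules. -/
theorem gProjDimLE_of_trivMod
    (hS : Function.Bijective (HopfAlgebra.antipode (R := k) (A := H))) (n : ℕ)
    (h : GProjDimLE H n (trivMod k H)) (M : ModuleCat.{u} H) : GProjDimLE H n M := by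
  obtain ⟨Λ, L, i, p, hip, hΛ, -⟩ := GProjDimLE.exists_embedding n _ h
  let v : trivMod k H := (1 : k)
  refine gProjDimLE_of_invariant hS n Λ (i v) (fun h ↦ ?_) (fun a ↦ ?_) hΛ M
  · exact one_ne_zero (α := k) (hip.inj (h.trans (map_zero i).symm))
  · rw [← map_smul, ← LinearMap.map_smul_of_tower]
    refine congrArg i ?_
    change (Coalgebra.counit a : k) * 1 = Coalgebra.counit (R := k) (algebraMap k H _) * 1
    simp

end Syzygies

section Transfer

open CategoryTheory

variable {R S : Type u} [Ring R] [Ring S]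

/-- A functor between module categories is exact. -/
structure PreservesExactness (F : ModuleCat.{u} R ⥤ ModuleCat.{u} S) : Prop where
  injective {A B : ModuleCat.{u} R} (f : A ⟶ B) :
    Function.Injective f.hom → Function.Injective (F.map f).hom
  exact {A B C : ModuleCat.{u} R} (f : A ⟶ B) (g : B ⟶ C) :
    Function.Exact f.hom g.hom → Function.Exact (F.map f).hom (F.map g).hom
  surjective {A B : ModuleCat.{u} R} (f : A ⟶ B) :
    Function.Surjective f.hom → Function.Surjective (F.map f).hom

theorem preservesExactness_restrictScalars (f : S →+* R) :
    PreservesExactness (ModuleCat.restrictScalars.{u} f) :=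
  ⟨fun _ h ↦ h, fun _ _ h ↦ h, fun _ h ↦ h⟩

theorem PreservesExactness.isShortExact {F : ModuleCat.{u} R ⥤ ModuleCat.{u} S}
    (hF : PreservesExactness F) {A B C : ModuleCat.{u} R} {f : A →ₗ[R] B} {g : B →ₗ[R] C}
    (h : IsShortExact f g) :
    IsShortExact (F.map (ModuleCat.ofHom f)).hom (F.map (ModuleCat.ofHom g)).hom :=
  ⟨hF.injective _ h.inj, hF.exact _ _ h.exact, hF.surjective _ h.surj⟩

theorem PreservesExactness.map_zero {F : ModuleCat.{u} R ⥤ ModuleCat.{u} S}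
    (hF : PreservesExactness F) (A B : ModuleCat.{u} R) : F.map (0 : A ⟶ B) = 0 := by
  have h := hF.exact (𝟙 A) (0 : A ⟶ B) fun x ↦ ⟨fun _ ↦ ⟨x, rfl⟩, fun _ ↦ rfl⟩
  rw [F.map_id] at h
  exact ModuleCat.hom_ext (LinearMap.ext fun x ↦ (h x).2 ⟨x, rfl⟩)

theorem PreservesExactness.hasProjectiveDimensionLT {F : ModuleCat.{u} R ⥤ ModuleCat.{u} S}
    (hF : PreservesExactness F)
    (hP : ∀ P : ModuleCat.{u} R, Module.Projective R P → Module.Projective S (F.obj P))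
    (n : ℕ) (M : ModuleCat.{u} R) (h : HasProjectiveDimensionLT M (n + 1)) :
    HasProjectiveDimensionLT (F.obj M) (n + 1) := by
  induction n generalizing M with
  | zero =>
    exact (hasProjectiveDimensionLT_one_iff _).2 (hP _ ((hasProjectiveDimensionLT_one_iff _).1 h))
  | succ n ih =>
    obtain ⟨K, P, i, p, hPp, hip⟩ := exists_isShortExact_of_projective M
    have := hP P hPp
    exact (hF.isShortExact hip).hasProjectiveDimensionLT_X₃ _
      (ih K (hip.hasProjectiveDimensionLT_X₁ _ (hasProjectiveDimensionLT_of_projective _ n) h))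
      (hasProjectiveDimensionLT_of_projective _ (n + 1))

/-- Restriction of scalars along `f : R →+* S` preserves projectives as soon as `S` is
projective over `R`. -/
theorem projective_restrictScalars (f : R →+* S)
    (hf : Module.Projective R ((ModuleCat.restrictScalars.{u} f).obj (ModuleCat.of S S)))
    (P : ModuleCat.{u} S) (hP : Module.Projective S P) :
    Module.Projective R ((ModuleCat.restrictScalars.{u} f).obj P) := by
  obtain ⟨s, hs⟩ := Module.projective_def'.1 hP
  let N := (ModuleCat.restrictScalars.{u} f).obj (ModuleCat.of S S)
  let s' : (ModuleCat.restrictScalars.{u} f).obj P →ₗ[R] (P →₀ N) :=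
    { toFun := s, map_add' := s.map_add, map_smul' := fun r x ↦ s.map_smul (f r) x }
  let p : (P →₀ S) →ₗ[S] P := Finsupp.linearCombination S id
  let p' : (P →₀ N) →ₗ[R] (ModuleCat.restrictScalars.{u} f).obj P :=
    { toFun := p, map_add' := p.map_add, map_smul' := fun r x ↦ p.map_smul (f r) x }
  classical
  have : Module.Projective R (P →₀ N) :=
    .of_equiv' (M := Π₀ _ : P, N) (finsuppLequivDFinsupp R).symm
  exact .of_split s' p' (LinearMap.ext fun x ↦ LinearMap.congr_fun hs x)

variable {F : ModuleCat.{u} R ⥤ ModuleCat.{u} S} {G : ModuleCat.{u} S ⥤ ModuleCat.{u} R}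

theorem IsGorensteinProjective.map_of_adjunction (adj : F ⊣ G) (hF : PreservesExactness F)
    (hG : PreservesExactness G)
    (hGP : ∀ P : ModuleCat.{u} S, Module.Projective S P → Module.Projective R (G.obj P))
    (M : ModuleCat.{u} R) (hM : IsGorensteinProjective R M) :
    IsGorensteinProjective S (F.obj M) := by
  obtain ⟨P, d, hP, hd, hQ, ⟨e⟩⟩ := hM
  have : G.PreservesEpimorphisms := ⟨fun f hf ↦ by
    rw [ModuleCat.epi_iff_surjective] at hf ⊢
    exact hG.surjective f hf⟩
  refine ⟨fun i ↦ F.obj (P i), fun i ↦ (F.map (ModuleCat.ofHom (d i))).hom, fun i ↦ ?_,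
    fun i ↦ ?_, fun Q hQ' i f hf ↦ ?_, ?_⟩
  · rw [IsProjective.iff_projective]
    exact adj.map_projective _ ((IsProjective.iff_projective _).1 (hP i))
  · exact (hF.exact _ _ (LinearMap.exact_iff.2 (hd i).symm)).linearMap_ker_eq.symm
  · let f' := adj.homEquiv _ _ (ModuleCat.ofHom f)
    obtain ⟨g, hg⟩ := hQ (G.obj Q) (hGP Q hQ') i f'.hom (by
      have h₁ : F.map (ModuleCat.ofHom (d (i + 1))) ≫ ModuleCat.ofHom f = 0 :=
        ModuleCat.hom_ext hf
      have h₂ : ModuleCat.ofHom (d (i + 1)) ≫ f' = 0 := by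
        rw [← adj.homEquiv_naturality_left, h₁, adj.homEquiv_unit, hG.map_zero,
          Limits.comp_zero]
      exact congrArg ModuleCat.Hom.hom h₂)
    refine ⟨((adj.homEquiv _ _).symm (ModuleCat.ofHom g)).hom, ?_⟩
    have h₁ : ModuleCat.ofHom (d i) ≫ ModuleCat.ofHom g = f' := ModuleCat.hom_ext hg
    have h₂ : F.map (ModuleCat.ofHom (d i)) ≫ (adj.homEquiv _ _).symm (ModuleCat.ofHom g) =
        ModuleCat.ofHom f := by
      rw [← adj.homEquiv_naturality_left_symm, h₁, Equiv.symm_apply_apply]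
    exact congrArg ModuleCat.Hom.hom h₂
  · have h : Function.Exact (((LinearMap.ker (d 0)).subtype) ∘ₗ e.toLinearMap) (d 0) := fun x ↦
      ⟨fun hx ↦ ⟨e.symm ⟨x, hx⟩, by simp⟩, by rintro ⟨y, rfl⟩; exact (e y).2⟩
    have hinj := hF.injective (ModuleCat.ofHom ((LinearMap.ker (d 0)).subtype ∘ₗ e.toLinearMap))
      (Subtype.val_injective.comp e.injective)
    exact ⟨(LinearEquiv.ofInjective _ hinj).trans (LinearEquiv.ofEq _ _
      (hF.exact (ModuleCat.ofHom ((LinearMap.ker (d 0)).subtype ∘ₗ e.toLinearMap))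
        (ModuleCat.ofHom (d 0)) h).linearMap_ker_eq.symm)⟩

theorem GProjDimLE.map_of_adjunction (adj : F ⊣ G) (hF : PreservesExactness F)
    (hG : PreservesExactness G)
    (hGP : ∀ P : ModuleCat.{u} S, Module.Projective S P → Module.Projective R (G.obj P))
    (n : ℕ) (M : ModuleCat.{u} R) (h : GProjDimLE R n M) : GProjDimLE S n (F.obj M) := by
  induction n generalizing M with
  | zero => exact IsGorensteinProjective.map_of_adjunction adj hF hG hGP M h
  | succ n ih =>
    obtain h | ⟨X, f, hX, hf, hK⟩ := h
    · exact .inl (h.map_of_adjunction adj hF hG hGP)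
    · have := hF.isShortExact (A := ModuleCat.of R (LinearMap.ker f)) (.subtype_ker f hf)
      obtain ⟨e⟩ := this.nonempty_equiv_ker
      exact .inr ⟨F.obj X, _, hX.map_of_adjunction adj hF hG hGP, this.surj,
        (ih (ModuleCat.of R (LinearMap.ker f)) hK).of_equiv e⟩

end Transfer

section Adjoint

attribute [local instance] ModuleCat.moduleOfAlgebraModule ModuleCat.isScalarTower_of_algebra_moduleCat

variable {k : Type u} [Field k] {H : Type u} [Ring H] [HopfAlgebra k H]

/-- The map `a ↦ ∑ a₁ ⊗ f(a₂ ⊗ a₃)` for `f` given by a convolution that is trivial on `H`. -/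
theorem map_conv_assoc_rTensor_comul {V W : Type u} [AddCommGroup V] [Module k V]
    [AddCommGroup W] [Module k W] (f : H →ₗ[k] V) (g : H →ₗ[k] W) (c : H ⊗[k] H →ₗ[k] H)
    (hc : ∀ a : H, c (Coalgebra.comul a) = algebraMap k H (Coalgebra.counit a)) (a : H) :
    TensorProduct.map f (g ∘ₗ c) (TensorProduct.assoc k H H H
      ((Coalgebra.comul (R := k)).rTensor H (Coalgebra.comul a))) = f a ⊗ₜ g 1 := by
  rw [Coalgebra.coassoc_apply]
  have h (x : H ⊗[k] H) : TensorProduct.map f (g ∘ₗ c)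
      ((Coalgebra.comul (R := k)).lTensor H x) =
      TensorProduct.map f (LinearMap.toSpanSingleton k W (g 1))
        ((Coalgebra.counit (R := k)).lTensor H x) := by
    induction x with
    | zero => simp
    | add x y hx hy => simp only [map_add, hx, hy]
    | tmul b d => simp [hc, Algebra.algebraMap_eq_smul_one]
  rw [h, Coalgebra.lTensor_counit_comul]
  simp

variable (k H) in
/-- The algebra homomorphism `h ↦ ∑ h₁ ⊗ S(h₂)` from `H` to its enveloping algebra. -/
noncomputable def adjointAlgHom : H →ₐ[k] H ⊗[k] Hᵐᵒᵖ :=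
  (Algebra.TensorProduct.map (AlgHom.id k H) (HopfAlgebra.antipodeAlgHomOp k H)).comp
    (Bialgebra.comulAlgHom k H)

theorem adjointAlgHom_apply (h : H) : adjointAlgHom k H h =
    TensorProduct.map LinearMap.id ((MulOpposite.opLinearEquiv k).toLinearMap ∘ₗ
      HopfAlgebra.antipode k) (Coalgebra.comul (R := k) h) := rfl

/-- The map `b ⊗ c ↦ (1 ⊗ cx) * ∑ b₁ ⊗ S(b₂)` to the enveloping algebra. -/
noncomputable def mulAdjoint (x : H) : H ⊗[k] H →ₗ[k] H ⊗[k] Hᵐᵒᵖ :=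
  TensorProduct.lift ((LinearMap.flip (LinearMap.mul k (H ⊗[k] Hᵐᵒᵖ)) ∘ₗ
    (adjointAlgHom k H).toLinearMap).compl₂ (TensorProduct.mk k H Hᵐᵒᵖ 1 ∘ₗ
      (MulOpposite.opLinearEquiv k).toLinearMap ∘ₗ LinearMap.mulRight k x))

theorem mulAdjoint_tmul (x b c : H) : mulAdjoint (k := k) x (b ⊗ₜ c) =
    ((1 : H) ⊗ₜ MulOpposite.op (c * x)) * adjointAlgHom k H b := rfl

theorem mulAdjoint_comul (x a : H) :
    mulAdjoint (k := k) x (Coalgebra.comul a) = a ⊗ₜ MulOpposite.op x := by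
  have h (t : H ⊗[k] H) : mulAdjoint (k := k) x t = TensorProduct.map LinearMap.id
      (((MulOpposite.opLinearEquiv k).toLinearMap ∘ₗ LinearMap.mulRight k x) ∘ₗ
        (LinearMap.mul' k H ∘ₗ (HopfAlgebra.antipode k).rTensor H))
      (TensorProduct.assoc k H H H ((Coalgebra.comul (R := k)).rTensor H t)) := by
    induction t with
    | zero => simp
    | add x y hx hy => simp only [map_add, hx, hy]
    | tmul a b =>
      rw [mulAdjoint_tmul, adjointAlgHom_apply, LinearMap.rTensor_tmul]
      generalize Coalgebra.comul (R := k) a = y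
      induction y with
      | zero => simp
      | add x y hx hy => simp only [TensorProduct.add_tmul, map_add, mul_add, hx, hy]
      | tmul a b => simp [mul_assoc]
  rw [h, map_conv_assoc_rTensor_comul _ _ _ HopfAlgebra.mul_antipode_rTensor_comul_apply]
  simp

section Induced

variable {M N : Type u} [AddCommGroup M] [Module k M] [AddCommGroup N] [Module k N]
  [Module (H ⊗[k] Hᵐᵒᵖ) N] [IsScalarTower k (H ⊗[k] Hᵐᵒᵖ) N]

variable (k H M) in
/-- Right multiplication on the second factor of `M ⊗[k] H`. -/
noncomputable def rightRep : Hᵐᵒᵖ →ₐ[k] Module.End k (M ⊗[k] H) :=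
  (Module.End.lTensorAlgHom k H M).comp (Algebra.lsmul k k H)

theorem rightRep_tmul (b : Hᵐᵒᵖ) (m : M) (x : H) :
    rightRep k H M b (m ⊗ₜ x) = m ⊗ₜ (x * b.unop) := rfl

/-- The map `m ⊗ x ↦ (1 ⊗ x) • g m`. -/
noncomputable def bimoduleLift (g : M →ₗ[k] N) : M ⊗[k] H →ₗ[k] N :=
  TensorProduct.lift (((Algebra.lsmul k k N).toLinearMap.flip ∘ₗ g).compl₂
    (TensorProduct.mk k H Hᵐᵒᵖ 1 ∘ₗ (MulOpposite.opLinearEquiv k).toLinearMap))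

theorem bimoduleLift_tmul (g : M →ₗ[k] N) (m : M) (x : H) :
    bimoduleLift g (m ⊗ₜ x) = ((1 : H) ⊗ₜ[k] MulOpposite.op x) • g m := rfl

variable [Module H M] [IsScalarTower k H M]

theorem commute_tensorRep_rightRep (a : H) (b : Hᵐᵒᵖ) :
    Commute (tensorRep k H M H a) (rightRep k H M b) :=
  LinearMap.ext fun t ↦ (tensorRep_map (LinearMap.id : M →ₗ[H] M)
    (LinearMap.toSpanSingleton H H b.unop) a t).symm

variable (k H M) in
/-- The action `(a ⊗ b) • (m ⊗ x) = ∑ a₁m ⊗ a₂xb` of the enveloping algebra on `M ⊗[k] H`. -/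
noncomputable def bimoduleRep : H ⊗[k] Hᵐᵒᵖ →ₐ[k] Module.End k (M ⊗[k] H) :=
  Algebra.TensorProduct.lift (tensorRep k H M H) (rightRep k H M) commute_tensorRep_rightRep

theorem bimoduleRep_tmul (a : H) (b : Hᵐᵒᵖ) (t : M ⊗[k] H) :
    bimoduleRep k H M (a ⊗ₜ b) t = rightRep k H M b (tensorRep k H M H a t) := by
  rw [← Module.End.mul_apply, ← (commute_tensorRep_rightRep a b).eq]
  rfl

theorem bimoduleRep_adjointAlgHom (a : H) (m : M) :
    bimoduleRep k H M (adjointAlgHom k H a) (m ⊗ₜ 1) = (a • m) ⊗ₜ 1 := by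
  rw [adjointAlgHom_apply]
  have h (t : H ⊗[k] H) : bimoduleRep k H M (TensorProduct.map LinearMap.id
      ((MulOpposite.opLinearEquiv k).toLinearMap ∘ₗ HopfAlgebra.antipode k) t) (m ⊗ₜ 1) =
      TensorProduct.map ((hRep k H M).toLinearMap.flip m) (LinearMap.id ∘ₗ
        (LinearMap.mul' k H ∘ₗ (HopfAlgebra.antipode k).lTensor H))
      (TensorProduct.assoc k H H H ((Coalgebra.comul (R := k)).rTensor H t)) := by
    induction t with
    | zero => simp
    | add x y hx hy => simp only [map_add, LinearMap.add_apply, hx, hy]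
    | tmul a b =>
      rw [TensorProduct.map_tmul, bimoduleRep_tmul, tensorRep_tmul, LinearMap.rTensor_tmul]
      generalize Coalgebra.comul (R := k) a = y
      induction y with
      | zero => simp
      | add x y hx hy => simp only [TensorProduct.add_tmul, map_add, hx, hy]
      | tmul c d => simp [rightRep_tmul, hRep]
  rw [h, map_conv_assoc_rTensor_comul _ _ _ HopfAlgebra.mul_antipode_lTensor_comul_apply]
  rfl

theorem bimoduleLift_smul (g : M →ₗ[k] N) (hg : ∀ (a : H) m, g (a • m) = adjointAlgHom k H a • g m)
    (r : H ⊗[k] Hᵐᵒᵖ) (t : M ⊗[k] H) :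
    bimoduleLift g (bimoduleRep k H M r t) = r • bimoduleLift g t := by
  induction t with
  | zero => simp
  | add x y hx hy => simp only [map_add, smul_add, hx, hy]
  | tmul m x =>
  induction r with
  | zero =>
    rw [map_zero, LinearMap.zero_apply, map_zero]
    exact (zero_smul (H ⊗[k] Hᵐᵒᵖ) (bimoduleLift g (m ⊗ₜ x))).symm
  | add x y hx hy => simp only [map_add, LinearMap.add_apply, add_smul, hx, hy]
  | tmul a b =>
    have h (s : H ⊗[k] H) : bimoduleLift g (rightRep k H M b
        (TensorProduct.map ((hRep k H M).toLinearMap.flip m) ((hRep k H H).toLinearMap.flip x) s)) =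
        mulAdjoint (x * b.unop) s • g m := by
      induction s with
      | zero =>
        simp only [map_zero]
        exact (zero_smul (H ⊗[k] Hᵐᵒᵖ) (g m)).symm
      | add x y hx hy => simp only [map_add, add_smul, hx, hy]
      | tmul c d =>
        rw [TensorProduct.map_tmul, rightRep_tmul, bimoduleLift_tmul, mulAdjoint_tmul, mul_smul,
          ← hg]
        simp [hRep, mul_assoc]
    rw [bimoduleRep_tmul, tensorRep_tmul, h, mulAdjoint_comul, bimoduleLift_tmul, smul_smul]
    simp

end Induced

end Adjoint

noncomputable section InducedFunctor

open CategoryTheory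

attribute [local instance] ModuleCat.moduleOfAlgebraModule ModuleCat.isScalarTower_of_algebra_moduleCat

variable (k : Type u) [Field k] (H : Type u) [Ring H] [HopfAlgebra k H]

/-- The bimodule `M ⊗[k] H` as an object of `ModuleCat (H ⊗[k] Hᵐᵒᵖ)`. -/
def bimodule (M : Type u) [AddCommGroup M] [Module k M] [Module H M] [IsScalarTower k H M] :
    ModuleCat.{u} (H ⊗[k] Hᵐᵒᵖ) :=
  @ModuleCat.of (H ⊗[k] Hᵐᵒᵖ) _ (M ⊗[k] H) _
    (Module.compHom (M ⊗[k] H) (bimoduleRep k H M).toRingHom)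

/-- A linear map as a morphism between objects of `ModuleCat`. -/
abbrev homOfLinearMap {R : Type u} [Ring R] {M N : ModuleCat.{u} R} (f : M →ₗ[R] N) : M ⟶ N :=
  ModuleCat.ofHom f

variable {k H} in
/-- The bimodule map `M ⊗[k] H → N ⊗[k] H` induced by an `H`-linear map. -/
def bimoduleMap {M N : ModuleCat.{u} H} (f : M →ₗ[H] N) :
    bimodule k H M →ₗ[H ⊗[k] Hᵐᵒᵖ] bimodule k H N where
  toFun := (f.restrictScalars k).rTensor H
  map_add' := map_add _
  map_smul' r (t : M ⊗[k] H) := by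
    change (f.restrictScalars k).rTensor H (bimoduleRep k H M r t) =
      bimoduleRep k H N r ((f.restrictScalars k).rTensor H t)
    induction r with
    | zero => simp
    | add x y hx hy => simp only [map_add, LinearMap.add_apply, hx, hy]
    | tmul a b =>
      have h (t : M ⊗[k] H) : (f.restrictScalars k).rTensor H (rightRep k H M b t) =
          rightRep k H N b ((f.restrictScalars k).rTensor H t) := by
        induction t with
        | zero => simp
        | add x y hx hy => simp only [map_add, hx, hy]
        | tmul m x => rfl
      rw [bimoduleRep_tmul, bimoduleRep_tmul, h]
      exact congrArg _ (tensorRep_map f LinearMap.id a t)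

/-- The functor `M ↦ M ⊗[k] H` from `H`-modules to `H`-bimodules. -/
def inducedBimodule : ModuleCat.{u} H ⥤ ModuleCat.{u} (H ⊗[k] Hᵐᵒᵖ) where
  obj M := bimodule k H M
  map f := homOfLinearMap (bimoduleMap f.hom)
  map_id M := ModuleCat.hom_ext (LinearMap.ext fun t ↦
    LinearMap.congr_fun (LinearMap.rTensor_id (R := k) H M) t)
  map_comp f g := ModuleCat.hom_ext (LinearMap.ext fun t ↦
    LinearMap.congr_fun (LinearMap.rTensor_comp H (g.hom.restrictScalars k)
      (f.hom.restrictScalars k)) t)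

theorem preservesExactness_inducedBimodule : PreservesExactness (inducedBimodule k H) :=
  ⟨fun f h ↦ Module.Flat.rTensor_preserves_injective_linearMap (M := H)
      (f.hom.restrictScalars k) h,
    fun f g h ↦ Module.Flat.rTensor_exact (M := H) (f := f.hom.restrictScalars k)
      (g := g.hom.restrictScalars k) h,
    fun f h ↦ LinearMap.rTensor_surjective H (g := f.hom.restrictScalars k) h⟩

variable {k H} {M : ModuleCat.{u} H} {N : ModuleCat.{u} (H ⊗[k] Hᵐᵒᵖ)}

variable (k H) in
/-- Restriction of a bimodule to its adjoint module, on which `h` acts as `∑ h₁ ⊗ S(h₂)`. -/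
abbrev adjointModule : ModuleCat.{u} (H ⊗[k] Hᵐᵒᵖ) ⥤ ModuleCat.{u} H :=
  ModuleCat.restrictScalars.{u} (adjointAlgHom k H).toRingHom

/-- An `H`-linear map into the adjoint module of a bimodule is `k`-linear. -/
def adjointToLinearMap (g : M →ₗ[H] (adjointModule k H).obj N) : M →ₗ[k] N where
  toFun := g
  map_add' := g.map_add
  map_smul' c m := (g.map_smul (algebraMap k H c) m).trans <| by
    change adjointAlgHom k H (algebraMap k H c) • (id (g m) : N) = _
    rw [AlgHom.commutes]
    rfl

/-- The bimodule map `m ⊗ x ↦ g m • x` extending an `H`-linear map. -/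
def adjointExtend (g : M →ₗ[H] (adjointModule k H).obj N) :
    bimodule k H M →ₗ[H ⊗[k] Hᵐᵒᵖ] N where
  toFun := bimoduleLift (adjointToLinearMap g)
  map_add' := map_add _
  map_smul' := bimoduleLift_smul (adjointToLinearMap g) g.map_smul

/-- The `H`-linear map `m ↦ φ (m ⊗ 1)`. -/
def adjointRestrict (φ : bimodule k H M →ₗ[H ⊗[k] Hᵐᵒᵖ] N) :
    M →ₗ[H] (adjointModule k H).obj N where
  toFun m := φ (m ⊗ₜ[k] (1 : H) : M ⊗[k] H)
  map_add' x y := (congrArg φ (TensorProduct.add_tmul x y (1 : H))).trans (φ.map_add _ _)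
  map_smul' h x := (congrArg φ (bimoduleRep_adjointAlgHom h x).symm).trans
    (φ.map_smul (adjointAlgHom k H h) _)

theorem bimodule_hom_ext {φ ψ : bimodule k H M →ₗ[H ⊗[k] Hᵐᵒᵖ] N}
    (h : ∀ m : M, φ (m ⊗ₜ[k] (1 : H) : M ⊗[k] H) = ψ (m ⊗ₜ[k] (1 : H) : M ⊗[k] H)) :
    φ = ψ := by
  refine LinearMap.ext fun (t : M ⊗[k] H) ↦ ?_
  induction t with
  | zero => exact φ.map_zero.trans ψ.map_zero.symm
  | add x y hx hy => exact (φ.map_add x y).trans ((congrArg₂ _ hx hy).trans (ψ.map_add x y).symm)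
  | tmul m x =>
    have hx : bimoduleRep k H M (1 ⊗ₜ MulOpposite.op x) (m ⊗ₜ 1) = m ⊗ₜ x := by
      rw [bimoduleRep_tmul, map_one, Module.End.one_apply, rightRep_tmul, MulOpposite.unop_op,
        one_mul]
    rw [← hx]
    exact (φ.map_smul _ _).trans ((congrArg _ (h m)).trans (ψ.map_smul _ _).symm)

theorem adjointExtend_tmul_one (g : M →ₗ[H] (adjointModule k H).obj N) (m : M) :
    adjointExtend g (m ⊗ₜ[k] (1 : H) : M ⊗[k] H) = g m :=
  (bimoduleLift_tmul _ m 1).trans (one_smul (H ⊗[k] Hᵐᵒᵖ) (adjointToLinearMap g m))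

/-- The adjunction between `M ↦ M ⊗[k] H` and restriction along `h ↦ ∑ h₁ ⊗ S(h₂)`. -/
def inducedBimoduleAdjunction : inducedBimodule k H ⊣ adjointModule k H :=
  Adjunction.mkOfHomEquiv
    { homEquiv M N :=
        { toFun φ := homOfLinearMap (adjointRestrict (M := M) φ.hom)
          invFun g := homOfLinearMap (adjointExtend g.hom)
          left_inv φ := ModuleCat.hom_ext <| bimodule_hom_ext (M := M) fun m ↦
            adjointExtend_tmul_one (N := N) (adjointRestrict (M := M) φ.hom) m
          right_inv g := ModuleCat.hom_ext <| LinearMap.ext fun m ↦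
            adjointExtend_tmul_one g.hom m }
      homEquiv_naturality_left_symm {M _ _} f g :=
        ModuleCat.hom_ext <| bimodule_hom_ext (M := M) fun m ↦
          (adjointExtend_tmul_one (f ≫ g).hom m).trans
            (adjointExtend_tmul_one g.hom (f.hom m)).symm
      homEquiv_naturality_right _ _ := rfl }

end InducedFunctor

section Bimodule

open CategoryTheory

attribute [local instance] ModuleCat.moduleOfAlgebraModule ModuleCat.isScalarTower_of_algebra_moduleCat

variable (k : Type u) [Field k] (H : Type u) [Ring H] [HopfAlgebra k H]

/-- The left `H`-module `Hᵐᵒᵖ`, where `h` acts by multiplication by `S(h)`. -/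
def AntipodeModule (_k H : Type u) : Type u := Hᵐᵒᵖ

noncomputable instance : AddCommGroup (AntipodeModule k H) := inferInstanceAs (AddCommGroup Hᵐᵒᵖ)

noncomputable instance : Module k (AntipodeModule k H) := inferInstanceAs (Module k Hᵐᵒᵖ)

noncomputable instance : Module H (AntipodeModule k H) :=
  Module.compHom Hᵐᵒᵖ (HopfAlgebra.antipodeAlgHomOp k H).toRingHom

instance : IsScalarTower k H (AntipodeModule k H) :=
  ⟨fun c h x ↦ by
    change HopfAlgebra.antipodeAlgHomOp k H (c • h) * (id x : Hᵐᵒᵖ) =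
      c • (HopfAlgebra.antipodeAlgHomOp k H h * (id x : Hᵐᵒᵖ))
    rw [map_smul, smul_mul_assoc]⟩

/-- The identity of `Hᵐᵒᵖ`. -/
noncomputable def antipodeModuleEquiv : AntipodeModule k H ≃ₗ[k] Hᵐᵒᵖ :=
  LinearEquiv.refl k Hᵐᵒᵖ

theorem antipodeModuleEquiv_smul (h : H) (x : AntipodeModule k H) :
    antipodeModuleEquiv k H (h • x) =
      MulOpposite.op (HopfAlgebra.antipode k h) * antipodeModuleEquiv k H x := rfl

theorem lTensor_antipodeModuleEquiv_tensorRep (h : H) (t : H ⊗[k] AntipodeModule k H) :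
    (antipodeModuleEquiv k H).lTensor H (tensorRep k H H (AntipodeModule k H) h t) =
      adjointAlgHom k H h * (antipodeModuleEquiv k H).lTensor H t := by
  induction t with
  | zero => simp
  | add x y hx hy => simp only [map_add, mul_add, hx, hy]
  | tmul a b =>
    rw [adjointAlgHom_apply, tensorRep_tmul]
    generalize Coalgebra.comul (R := k) h = x
    induction x with
    | zero => simp
    | add x y hx hy => simp only [map_add, add_mul, hx, hy]
    | tmul c d => simp [hRep, antipodeModuleEquiv_smul]

theorem projective_adjointModule_self :
    Module.Projective H ((adjointModule k H).obj (ModuleCat.of (H ⊗[k] Hᵐᵒᵖ) (H ⊗[k] Hᵐᵒᵖ))) := by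
  have := projective_tensorMod_right k (AntipodeModule k H) H (H := H)
  let e : tensorMod k H H (AntipodeModule k H) ≃ₗ[H]
      (adjointModule k H).obj (ModuleCat.of (H ⊗[k] Hᵐᵒᵖ) (H ⊗[k] Hᵐᵒᵖ)) :=
    { ((tensorModEquiv k H H (AntipodeModule k H)).symm ≪≫ₗ
        (antipodeModuleEquiv k H).lTensor H).toAddEquiv with
      map_smul' := lTensor_antipodeModuleEquiv_tensorRep k H }
  exact .of_equiv e

theorem projective_adjointModule (P : ModuleCat.{u} (H ⊗[k] Hᵐᵒᵖ))
    (hP : Module.Projective (H ⊗[k] Hᵐᵒᵖ) P) : Module.Projective H ((adjointModule k H).obj P) :=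
  projective_restrictScalars _ (projective_adjointModule_self k H) P hP

variable {k H} [iE : Module (H ⊗[k] Hᵐᵒᵖ) H]

theorem adjointAlgHom_smul_one
    (hiE : ∀ a b x : H, (a ⊗ₜ[k] MulOpposite.op b) • x = a * x * b) (h : H) :
    adjointAlgHom k H h • (1 : H) = algebraMap k H (Coalgebra.counit h) := by
  rw [adjointAlgHom_apply, ← HopfAlgebra.mul_antipode_lTensor_comul_apply]
  generalize Coalgebra.comul (R := k) h = x
  induction x with
  | zero => simpa only [map_zero] using zero_smul (H ⊗[k] Hᵐᵒᵖ) (1 : H)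
  | add x y hx hy => simp only [map_add, add_smul, hx, hy]
  | tmul a b => simp [hiE]

theorem GProjDimLE.of_bimodule (hS : Function.Bijective (HopfAlgebra.antipode (R := k) (A := H)))
    (hiE : ∀ a b x : H, (a ⊗ₜ[k] MulOpposite.op b) • x = a * x * b)
    (n : ℕ) (h : GProjDimLE (H ⊗[k] Hᵐᵒᵖ) n H) (M : ModuleCat.{u} H) : GProjDimLE H n M := by
  obtain ⟨Λ, L, i, p, hip, hΛ, -⟩ := h.exists_embedding n (ModuleCat.of (H ⊗[k] Hᵐᵒᵖ) H)
  have hΛ' := (preservesExactness_restrictScalars (adjointAlgHom k H).toRingHom).hasProjectiveDimensionLT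
    (projective_adjointModule k H) n Λ hΛ
  have : Nontrivial H := (Bialgebra.counitAlgHom k H).toRingHom.domain_nontrivial
  have key (a : H) : adjointAlgHom k H a • i (1 : H) = i (algebraMap k H (Coalgebra.counit a)) := by
    rw [← adjointAlgHom_smul_one hiE]
    exact (i.map_smul _ (1 : H)).symm
  refine gProjDimLE_of_invariant hS n ((adjointModule k H).obj Λ) (i (1 : H)) (fun h ↦ ?_)
    (fun a ↦ ?_) hΛ' M
  · exact one_ne_zero (α := H) (hip.inj (h.trans (map_zero i).symm))
  · refine (key a).trans (Eq.trans ?_ (key (algebraMap k H (Coalgebra.counit a))).symm)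
    simp

theorem GProjDimLE.bimodule_of_trivMod
    (hiE : ∀ a b x : H, (a ⊗ₜ[k] MulOpposite.op b) • x = a * x * b)
    (n : ℕ) (h : GProjDimLE H n (trivMod k H)) :
    GProjDimLE (H ⊗[k] Hᵐᵒᵖ) n H := by
  have h' := h.map_of_adjunction inducedBimoduleAdjunction (preservesExactness_inducedBimodule k H)
    (preservesExactness_restrictScalars _) (projective_adjointModule k H)
  let e₀ : trivMod k H ≃ₗ[k] k :=
    { AddEquiv.refl k with
      map_smul' := fun c (x : k) ↦ by
        change Coalgebra.counit (R := k) (algebraMap k H c) * x = c * x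
        simp }
  have he (a : H) (x : trivMod k H) : e₀ (a • x) = Coalgebra.counit (R := k) a * e₀ x := rfl
  let e₁ : trivMod k H ⊗[k] H ≃ₗ[k] H := e₀.rTensor H ≪≫ₗ TensorProduct.lid k H
  have key (r : H ⊗[k] Hᵐᵒᵖ) (t : trivMod k H ⊗[k] H) :
      e₁ (bimoduleRep k H (trivMod k H) r t) = r • e₁ t := by
    induction r with
    | zero =>
      rw [map_zero, LinearMap.zero_apply, map_zero]
      exact (zero_smul (H ⊗[k] Hᵐᵒᵖ) (e₁ t)).symm
    | add x y hx hy => simp only [map_add, LinearMap.add_apply, add_smul, hx, hy]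
    | tmul a b =>
      induction t with
      | zero => simp
      | add x y hx hy => simp only [map_add, smul_add, hx, hy]
      | tmul c x =>
        have h (s : H ⊗[k] H) : e₁ (rightRep k H _ b (TensorProduct.map
            ((hRep k H (trivMod k H)).toLinearMap.flip c) ((hRep k H H).toLinearMap.flip x) s)) =
            e₀ c • (TensorProduct.lid k H (TensorProduct.map Coalgebra.counit
              ((hRep k H H).toLinearMap.flip x) s) * b.unop) := by
          induction s with
          | zero => simp
          | add x y hx hy => simp only [map_add, add_mul, smul_add, hx, hy]
          | tmul d f => simp [rightRep_tmul, e₁, hRep, he, mul_smul, smul_comm (e₀ c)]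
        have hb : e₁ (c ⊗ₜ x) = e₀ c • x := by simp [e₁]
        rw [bimoduleRep_tmul, tensorRep_tmul, h, lift_counit_smul_comul, hb, ← b.op_unop, hiE,
          MulOpposite.unop_op, mul_smul_comm, smul_mul_assoc, smul_mul_assoc, mul_assoc, smul_eq_mul]
  let e : bimodule k H (trivMod k H) ≃ₗ[H ⊗[k] Hᵐᵒᵖ] ModuleCat.of (H ⊗[k] Hᵐᵒᵖ) H :=
    { e₁.toAddEquiv with map_smul' := key }
  exact h'.of_equiv e

end Bimodule

section Opposite

open CategoryTheory

variable {R S : Type u} [Ring R] [Ring S]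

theorem GProjDimLE.restrictScalars (σ : R ≃+* S) (n : ℕ) (M : ModuleCat.{u} S)
    (h : GProjDimLE S n M) : GProjDimLE R n ((ModuleCat.restrictScalars.{u} σ.toRingHom).obj M) :=
  h.map_of_adjunction (ModuleCat.restrictScalarsEquivalenceOfRingEquiv σ).toAdjunction
    (preservesExactness_restrictScalars _) (preservesExactness_restrictScalars _)
    (fun P hP ↦ by
      have := RingHomInvPair.of_ringEquiv σ
      have := RingHomInvPair.symm (σ : R →+* S) (σ.symm : S →+* R)
      let e : P ≃ₛₗ[(σ : R →+* S)] (ModuleCat.restrictScalars.{u} σ.symm.toRingHom).obj P :=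
        { AddEquiv.refl P with
          map_smul' := fun r x ↦ by
            change r • x = σ.symm (σ r) • (id x : P)
            rw [σ.symm_apply_apply, id] }
      exact .of_equiv e)

theorem gProjDimLE_of_ringEquiv (σ : R ≃+* S) (n : ℕ) (h : ∀ M : ModuleCat.{u} R, GProjDimLE R n M)
    (M : ModuleCat.{u} S) : GProjDimLE S n M := by
  let N := (ModuleCat.restrictScalars.{u} σ.toRingHom).obj M
  let e : (ModuleCat.restrictScalars.{u} σ.symm.toRingHom).obj N ≃ₗ[S] M :=
    { AddEquiv.refl M with
      map_smul' := fun s (x : M) ↦ by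
        change σ (σ.symm s) • x = s • x
        rw [σ.apply_symm_apply] }
  exact (GProjDimLE.restrictScalars σ.symm n N (h N)).of_equiv e

variable {k : Type u} [Field k] {H : Type u} [Ring H] [HopfAlgebra k H]

/-- The bijective antipode as an isomorphism from `H` to its opposite. -/
noncomputable def antipodeRingEquivOp
    (hS : Function.Bijective (HopfAlgebra.antipode (R := k) (A := H))) : H ≃+* Hᵐᵒᵖ :=
  RingEquiv.ofBijective (HopfAlgebra.antipodeAlgHomOp k H)
    (MulOpposite.op_bijective.comp hS)

theorem gProjDimLE_trivModOp (hS : Function.Bijective (HopfAlgebra.antipode (R := k) (A := H)))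
    (n : ℕ) (h : GProjDimLE H n (trivMod k H)) : GProjDimLE Hᵐᵒᵖ n (trivModOp k H) := by
  let σ := antipodeRingEquivOp hS
  let e : (ModuleCat.restrictScalars.{u} σ.symm.toRingHom).obj (trivMod k H) ≃ₗ[Hᵐᵒᵖ]
      trivModOp k H :=
    { AddEquiv.refl k with
      map_smul' := fun s (x : k) ↦ by
        obtain ⟨a, rfl⟩ := σ.surjective s
        change Coalgebra.counit (R := k) (σ.symm (σ a)) * x =
          Coalgebra.counit (R := k) (HopfAlgebra.antipode k a) * x
        rw [RingEquiv.symm_apply_apply, HopfAlgebra.counit_antipode] }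
  exact (GProjDimLE.restrictScalars σ.symm n _ h).of_equiv e

theorem gProjDimLE_trivMod (hS : Function.Bijective (HopfAlgebra.antipode (R := k) (A := H)))
    (n : ℕ) (h : GProjDimLE Hᵐᵒᵖ n (trivModOp k H)) : GProjDimLE H n (trivMod k H) := by
  let σ := antipodeRingEquivOp hS
  let e : (ModuleCat.restrictScalars.{u} σ.toRingHom).obj (trivModOp k H) ≃ₗ[H] trivMod k H :=
    { AddEquiv.refl k with
      map_smul' := fun a (x : k) ↦ by
        change Coalgebra.counit (R := k) (HopfAlgebra.antipode k a) * x =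
          Coalgebra.counit (R := k) a * x
        rw [HopfAlgebra.counit_antipode] }
  exact (GProjDimLE.restrictScalars σ n _ h).of_equiv e

theorem gProjDim_congr {M N : Type u} [AddCommGroup M] [Module R M] [AddCommGroup N] [Module S N]
    (h : ∀ n, GProjDimLE R n M ↔ GProjDimLE S n N) : gProjDim R M = gProjDim S N := by
  simp only [gProjDim, h]

theorem lGgldim_eq_gProjDim {M : Type u} [AddCommGroup M] [Module R M]
    (h : ∀ n, GProjDimLE R n M → ∀ N : ModuleCat.{u} R, GProjDimLE R n N) :
    lGgldim R = gProjDim R M :=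
  le_antisymm (iSup_le fun N ↦ sInf_le_sInf fun _ ⟨m, hm, hM⟩ ↦ ⟨m, hm, h m hM N⟩)
    (le_iSup (fun N : ModuleCat.{u} R ↦ gProjDim R N) (ModuleCat.of R M))

end Opposite

/-- Let `H` be a Hopf algebra over a field `k` with bijective antipode and
`H^e = H ⊗[k] Hᵒᵖ` its enveloping algebra. Then
`l.Ggldim(H) = Gpd_H(εk) = Gpd_{H^e}(H) = r.Ggldim(H) = Gpd_{Hᵒᵖ}(k_ε)`,
where `H` carries its regular bimodule structure `(a ⊗ bᵒᵖ) • x = a x b`. -/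
theorem lGgldim_eq_rGgldim (k : Type u) [Field k]
    (H : Type u) [Ring H] [HopfAlgebra k H]
    (hS : Function.Bijective (HopfAlgebra.antipode (R := k) (A := H)))
    (iE : Module (H ⊗[k] Hᵐᵒᵖ) H)
    (hiE : ∀ (a b x : H), modSMul iE (a ⊗ₜ[k] (MulOpposite.op b)) x = a * x * b) :
    lGgldim H = gProjDim H (trivMod k H) ∧
    gProjDim H (trivMod k H) = @gProjDim (H ⊗[k] Hᵐᵒᵖ) _ H _ iE ∧
    @gProjDim (H ⊗[k] Hᵐᵒᵖ) _ H _ iE = lGgldim Hᵐᵒᵖ ∧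
    lGgldim Hᵐᵒᵖ = gProjDim Hᵐᵒᵖ (trivModOp k H) := by
  have hiE' (a b x : H) : (a ⊗ₜ[k] MulOpposite.op b) • x = a * x * b := hiE a b x
  have triv_iff (n : ℕ) :
      GProjDimLE H n (trivMod k H) ↔ GProjDimLE (H ⊗[k] Hᵐᵒᵖ) n H :=
    ⟨GProjDimLE.bimodule_of_trivMod hiE' n, fun h ↦ h.of_bimodule hS hiE' n (trivMod k H)⟩
  have trivOp_iff (n : ℕ) :
      GProjDimLE H n (trivMod k H) ↔ GProjDimLE Hᵐᵒᵖ n (trivModOp k H) :=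
    ⟨gProjDimLE_trivModOp hS n, gProjDimLE_trivMod hS n⟩
  have hE := gProjDim_congr triv_iff
  have hop : lGgldim Hᵐᵒᵖ = gProjDim Hᵐᵒᵖ (trivModOp k H) := lGgldim_eq_gProjDim fun n h ↦
    gProjDimLE_of_ringEquiv (antipodeRingEquivOp hS) n
      (gProjDimLE_of_trivMod hS n ((trivOp_iff n).2 h))
  exact ⟨lGgldim_eq_gProjDim (gProjDimLE_of_trivMod hS), hE,
    hE.symm.trans ((gProjDim_congr trivOp_iff).trans hop.symm), hop⟩
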